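/- Let (λ_f, μ_f, f, e_f) and (λ_g, μ_g, g, e_g) be two regular solutions of the full spherically symmetric Einstein–Vlasov–Maxwell system on a common interval [0,T) with the same initial data: λ_f(0) = λ_g(0), μ_f(0) = μ_g(0), f(0) = g(0), e_f(0) = e_g(0). Then f(t) = g(t), λ_f(t) = λ_g(t), μ_f(t) = μ_g(t), and e_f(t) = e_g(t) for all t ∈ [0,T). -/

import Mathlib

/- Common definitions for the spherically symmetric Einstein–Vlasov–Maxwell system. -/

noncomputable section
open Real MeasureTheory Filter Topology Matrix intervalIntegral
open scoped Classical ENNReal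

namespace EVM

/-- Euclidean 3-space. -/
abbrev E3 : Type := EuclideanSpace ℝ (Fin 3)

/-- `√(1+|v|²)`. -/
def w (v : E3) : ℝ := Real.sqrt (1 + ‖v‖ ^ 2)

/-- Action of a 3×3 matrix on `E3`. -/
def act (A : Matrix (Fin 3) (Fin 3) ℝ) (x : E3) : E3 := WithLp.toLp 2 (fun i => ∑ j, A i j * x j)

/-- Membership in SO(3). -/
def SO3 (A : Matrix (Fin 3) (Fin 3) ℝ) : Prop := Aᵀ * A = 1 ∧ A.det = 1

/-- A function on `ℝ³ × ℝ³` is spherically symmetric if it is invariant under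
simultaneous rotations of both arguments. -/
def SphSymm (g : E3 → E3 → ℝ) : Prop :=
  ∀ A : Matrix (Fin 3) (Fin 3) ℝ, SO3 A → ∀ x v : E3, g (act A x) (act A v) = g x v

/-- The reference point of radius `r` on the first coordinate axis. -/
def pt (r : ℝ) : E3 := EuclideanSpace.single 0 r

/-- Euclidean divergence of a vector field on `ℝ³`. -/
def div3 (G : E3 → E3) (x : E3) : ℝ :=
  ∑ i : Fin 3, fderiv ℝ (fun y => G y i) x (EuclideanSpace.single i 1)

/-! ### Regularity notions -/

/-- `C²` on `I × [0,∞)`. -/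
def C2On (I : Set ℝ) (g : ℝ → ℝ → ℝ) : Prop :=
  ContDiffOn ℝ 2 (fun p : ℝ × ℝ => g p.1 p.2) (I ×ˢ Set.Ici (0:ℝ))

/-- `g(t,r) → 0` as `r → ∞`, for each `t ∈ I`. -/
def ZeroAtInfty (I : Set ℝ) (g : ℝ → ℝ → ℝ) : Prop :=
  ∀ t ∈ I, Tendsto (g t) atTop (nhds 0)

/-- Regularity of the metric pair `(λ, μ)` on `I × [0,∞)`, including the boundary
conditions `λ(t,r), μ(t,r) → 0` as `r → ∞`, `λ(t,0) = 0`, and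
`λ̇(t,0) = λ′(t,0) = μ′(t,0) = 0`. -/
def RegMetric2 (I : Set ℝ) (lam mu : ℝ → ℝ → ℝ) : Prop :=
  C2On I lam ∧ C2On I mu ∧ ZeroAtInfty I lam ∧ ZeroAtInfty I mu ∧
  (∀ t ∈ I, lam t 0 = 0) ∧
  (∀ t ∈ I, deriv (fun s => lam s 0) t = 0) ∧
  (∀ t ∈ I, deriv (lam t) 0 = 0) ∧
  (∀ t ∈ I, deriv (mu t) 0 = 0)

/-- Regularity of the triple `(λ, μ, λ̃)` on `I × [0,∞)`: additionally `λ̃` is `C²`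
with `λ̃′(t,0) = 0`. -/
def RegMetric3 (I : Set ℝ) (lam mu lamT : ℝ → ℝ → ℝ) : Prop :=
  RegMetric2 I lam mu ∧ C2On I lamT ∧ (∀ t ∈ I, deriv (lamT t) 0 = 0)

/-- Regularity of the electric field coefficient `e`: `e` and `e′` are continuous on
`I × [0,∞)`, `e(t,0) = 0` and `e(t,r) → 0` as `r → ∞`. -/
def RegField (I : Set ℝ) (e : ℝ → ℝ → ℝ) : Prop :=
  ContinuousOn (fun p : ℝ × ℝ => e p.1 p.2) (I ×ˢ Set.Ici (0:ℝ)) ∧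
  ContinuousOn (fun p : ℝ × ℝ => deriv (e p.1) p.2) (I ×ˢ Set.Ici (0:ℝ)) ∧
  (∀ t ∈ I, e t 0 = 0) ∧ ZeroAtInfty I e

/-- Regularity of a distribution function: `C¹`, nonnegative, spherically symmetric
with compact support at each time. -/
def RegDist (I : Set ℝ) (f : ℝ → E3 → E3 → ℝ) : Prop :=
  ContDiffOn ℝ 1 (fun p : ℝ × (E3 × E3) => f p.1 p.2.1 p.2.2)
    (I ×ˢ (Set.univ : Set (E3 × E3))) ∧
  (∀ t ∈ I, ∀ x v : E3, 0 ≤ f t x v) ∧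
  (∀ t ∈ I, SphSymm (f t)) ∧
  (∀ t ∈ I, HasCompactSupport (fun z : E3 × E3 => f t z.1 z.2))

/-! ### The characteristic field -/

/-- Spatial part of the characteristic field. -/
def F1 (lam mu : ℝ → ℝ → ℝ) (s : ℝ) (x v : E3) : E3 :=
  (Real.exp (mu s ‖x‖ - lam s ‖x‖) / w v) • v

/-- Momentum part of the characteristic field. -/
def F2 (q : ℝ) (lam mu lamT e : ℝ → ℝ → ℝ) (s : ℝ) (x v : E3) : E3 :=
  if x = 0 then 0 else
    (-(lamT s ‖x‖ * ((inner ℝ x v : ℝ) / ‖x‖)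
        + Real.exp (mu s ‖x‖ - lam s ‖x‖) * deriv (mu s) ‖x‖ * w v
        - q * Real.exp (mu s ‖x‖ + lam s ‖x‖) * e s ‖x‖) / ‖x‖) • x

/-- The full characteristic field `F = (F₁, F₂)`. -/
def Fchar (q : ℝ) (lam mu lamT e : ℝ → ℝ → ℝ) (s : ℝ) (z : E3 × E3) : E3 × E3 :=
  (F1 lam mu s z.1 z.2, F2 q lam mu lamT e s z.1 z.2)

/-- The (modified) Vlasov equation with time-derivative coefficient `λ̃ = lamT`. -/
def VlasovEq (q : ℝ) (I : Set ℝ) (lam mu lamT e : ℝ → ℝ → ℝ)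
    (f : ℝ → E3 → E3 → ℝ) : Prop :=
  ∀ t ∈ I, ∀ x v : E3,
    deriv (fun s => f s x v) t
      + fderiv ℝ (fun y => f t y v) x (F1 lam mu t x v)
      + fderiv ℝ (fun u => f t x u) v (F2 q lam mu lamT e t x v) = 0

/-! ### Source terms (as functions of `(t,r)`, evaluated along the first axis) -/

/-- Energy density `ρ`. -/
def rho (lam e : ℝ → ℝ → ℝ) (f : ℝ → E3 → E3 → ℝ) (t r : ℝ) : ℝ :=
  (∫ v : E3, w v * f t (pt r) v) + (1/2) * Real.exp (2 * lam t r) * (e t r) ^ 2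

/-- Radial pressure `p`. -/
def prs (lam e : ℝ → ℝ → ℝ) (f : ℝ → E3 → E3 → ℝ) (t r : ℝ) : ℝ :=
  (∫ v : E3, (v 0) ^ 2 / w v * f t (pt r) v) - (1/2) * Real.exp (2 * lam t r) * (e t r) ^ 2

/-- Momentum density `k`. -/
def kk (f : ℝ → E3 → E3 → ℝ) (t r : ℝ) : ℝ := ∫ v : E3, (v 0) * f t (pt r) v

/-- Tangential pressure term `q̄`. -/
def qbar (lam e : ℝ → ℝ → ℝ) (f : ℝ → E3 → E3 → ℝ) (t r : ℝ) : ℝ :=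
  (∫ v : E3, (‖v‖ ^ 2 - (v 0) ^ 2) / w v * f t (pt r) v)
    + Real.exp (2 * lam t r) * (e t r) ^ 2

/-- Charge density `M`. -/
def Mch (f : ℝ → E3 → E3 → ℝ) (t r : ℝ) : ℝ := ∫ v : E3, f t (pt r) v

/-- Current term `N`. -/
def Ncur (f : ℝ → E3 → E3 → ℝ) (t r : ℝ) : ℝ := ∫ v : E3, (r * v 0) / w v * f t (pt r) v

/-- Quasi-local mass `m(t,r) = 4π ∫₀ʳ s² ρ(t,s) ds`. -/
def mqm (lam e : ℝ → ℝ → ℝ) (f : ℝ → E3 → E3 → ℝ) (t r : ℝ) : ℝ :=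
  4 * π * ∫ s in (0:ℝ)..r, s ^ 2 * rho lam e f t s

/-! ### The field equations -/

/-- Einstein equation (2.6): `e^{−2λ}(2rλ′ − 1) + 1 = 8πr²ρ`. -/
def Eq2_6 (I : Set ℝ) (lam e : ℝ → ℝ → ℝ) (f : ℝ → E3 → E3 → ℝ) : Prop :=
  ∀ t ∈ I, ∀ r : ℝ, 0 ≤ r →
    Real.exp (-2 * lam t r) * (2 * r * deriv (lam t) r - 1) + 1
      = 8 * π * r ^ 2 * rho lam e f t r

/-- Einstein equation (2.7): `λ̇ = −4πr e^{λ+μ} k`. -/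
def Eq2_7 (I : Set ℝ) (lam mu : ℝ → ℝ → ℝ) (f : ℝ → E3 → E3 → ℝ) : Prop :=
  ∀ t ∈ I, ∀ r : ℝ, 0 ≤ r →
    deriv (fun s => lam s r) t
      = -(4 * π) * r * Real.exp (lam t r + mu t r) * kk f t r

/-- Einstein equation (2.8) in the form `e^{−2λ}(2rμ′ + 1) − 1 = 8πr²p`. -/
def Eq2_8 (I : Set ℝ) (lam mu e : ℝ → ℝ → ℝ) (f : ℝ → E3 → E3 → ℝ) : Prop :=
  ∀ t ∈ I, ∀ r : ℝ, 0 ≤ r →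
    Real.exp (-2 * lam t r) * (2 * r * deriv (mu t) r + 1) - 1
      = 8 * π * r ^ 2 * prs lam e f t r

/-- Einstein equation (2.9) (second order). -/
def Eq2_9 (I : Set ℝ) (lam mu e : ℝ → ℝ → ℝ) (f : ℝ → E3 → E3 → ℝ) : Prop :=
  ∀ t ∈ I, ∀ r : ℝ, 0 < r →
    Real.exp (-2 * lam t r) *
        (deriv (deriv (mu t)) r
          + (deriv (mu t) r - deriv (lam t) r) * (deriv (mu t) r + 1 / r))
      - Real.exp (-2 * mu t r) *
        (deriv (fun s => deriv (fun τ => lam τ r) s) t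
          + deriv (fun s => lam s r) t
            * (deriv (fun s => lam s r) t - deriv (fun s => mu s r) t))
      = 4 * π * qbar lam e f t r

/-- Maxwell equation (2.11): `∂ᵣ(r² e^{λ} e) = q r² e^{λ} M`. -/
def Max2_11 (q : ℝ) (I : Set ℝ) (lam e : ℝ → ℝ → ℝ) (f : ℝ → E3 → E3 → ℝ) : Prop :=
  ∀ t ∈ I, ∀ r : ℝ, 0 ≤ r →
    deriv (fun s => s ^ 2 * Real.exp (lam t s) * e t s) r
      = q * r ^ 2 * Real.exp (lam t r) * Mch f t r

/-- Maxwell equation (2.12): `∂ₜ(e^{λ} e) = −(q/r) e^{μ} N`. -/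
def Max2_12 (q : ℝ) (I : Set ℝ) (lam mu e : ℝ → ℝ → ℝ) (f : ℝ → E3 → E3 → ℝ) : Prop :=
  ∀ t ∈ I, ∀ r : ℝ, 0 < r →
    deriv (fun s => Real.exp (lam s r) * e s r) t
      = -(q / r) * Real.exp (mu t r) * Ncur f t r

/-- The full spherically symmetric Einstein–Vlasov–Maxwell system
(2.6)–(2.12), the Vlasov equation taken with `λ̃ = λ̇`. -/
def FullSystem (q : ℝ) (I : Set ℝ) (lam mu e : ℝ → ℝ → ℝ) (f : ℝ → E3 → E3 → ℝ) : Prop :=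
  Eq2_6 I lam e f ∧ Eq2_7 I lam mu f ∧ Eq2_8 I lam mu e f ∧ Eq2_9 I lam mu e f ∧
  VlasovEq q I lam mu (fun t r => deriv (fun s => lam s r) t) e f ∧
  Max2_11 q I lam e f ∧ Max2_12 q I lam mu e f

/-- A regular solution of the full system on `I` (regularity includes the
asymptotically flat boundary conditions). -/
def RegularSolution (q : ℝ) (I : Set ℝ) (lam mu e : ℝ → ℝ → ℝ)
    (f : ℝ → E3 → E3 → ℝ) : Prop :=
  RegMetric2 I lam mu ∧ RegField I e ∧ RegDist I f ∧ FullSystem q I lam mu e f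



lemma one_le_w (v : E3) : 1 ≤ w v := by
  unfold w; rw [Real.one_le_sqrt]; nlinarith [sq_nonneg ‖v‖]

lemma w_pos (v : E3) : 0 < w v := lt_of_lt_of_le one_pos (one_le_w v)

lemma norm_le_w (v : E3) : ‖v‖ ≤ w v := by
  unfold w; apply Real.le_sqrt_of_sq_le; linarith

lemma w_le (v : E3) : w v ≤ 1 + ‖v‖ := by
  unfold w; apply Real.sqrt_le_iff.2
  have := norm_nonneg v
  constructor <;> nlinarith

lemma w_cont : Continuous w := by
  unfold w; fun_prop

lemma w_line (x G : E3) :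
    HasDerivAt (fun s : ℝ => w (x + s • G)) ((inner ℝ x G : ℝ) / w x) 0 := by
  have h1 : HasDerivAt (fun s : ℝ => x + s • G) G 0 := by
    simpa using ((hasDerivAt_id (0:ℝ)).smul_const G).const_add x
  have h2 := (h1.norm_sq).const_add 1
  have h3 := h2.sqrt (by positivity)
  unfold w
  convert h3 using 1
  simp
  have : √(1 + ‖x‖ ^ 2) ≠ 0 := by positivity
  field_simp

lemma w_line_abs (x G : E3) : |(inner ℝ x G : ℝ) / w x| ≤ ‖G‖ := by
  rw [abs_div, abs_of_pos (w_pos x), div_le_iff₀ (w_pos x)]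
  calc _ ≤ ‖x‖ * ‖G‖ := abs_real_inner_le_norm x G
    _ ≤ w x * ‖G‖ := by gcongr; exact norm_le_w x
    _ = _ := mul_comm _ _

lemma C2_slice_r {T t : ℝ} {g : ℝ → ℝ → ℝ} (h : C2On (Set.Ico 0 T) g) (ht : t ∈ Set.Ico 0 T) :
    ContDiffOn ℝ 2 (g t) (Set.Ici 0) := by
  have : ContDiffOn ℝ 2 (fun r : ℝ => ((t, r) : ℝ × ℝ)) (Set.Ici 0) := by
    apply ContDiff.contDiffOn; fun_prop
  exact ContDiffOn.comp (g := fun p : ℝ × ℝ => g p.1 p.2) h this (fun r hr => ⟨ht, hr⟩)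

lemma C2_slice_t {T r : ℝ} {g : ℝ → ℝ → ℝ} (h : C2On (Set.Ico 0 T) g) (hr : 0 ≤ r) :
    ContDiffOn ℝ 2 (fun t => g t r) (Set.Ico 0 T) := by
  have : ContDiffOn ℝ 2 (fun t : ℝ => ((t, r) : ℝ × ℝ)) (Set.Ico 0 T) := by
    apply ContDiff.contDiffOn; fun_prop
  exact ContDiffOn.comp h this (fun t ht => ⟨ht, hr⟩)

lemma C2_diff_r {T t r : ℝ} {g : ℝ → ℝ → ℝ} (h : C2On (Set.Ico 0 T) g) (ht : t ∈ Set.Ico 0 T)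
    (hr : 0 < r) : DifferentiableAt ℝ (g t) r :=
  ((C2_slice_r h ht).contDiffAt (Ici_mem_nhds hr)).differentiableAt (by norm_num)

lemma C2_diff_r2 {T t r : ℝ} {g : ℝ → ℝ → ℝ} (h : C2On (Set.Ico 0 T) g) (ht : t ∈ Set.Ico 0 T)
    (hr : 0 < r) : DifferentiableAt ℝ (deriv (g t)) r := by
  have h1 : ContDiffAt ℝ (1 + 1) (g t) r :=
    ((C2_slice_r h ht).contDiffAt (Ici_mem_nhds hr)).of_le (by norm_num)
  have h2 : ContDiffAt ℝ 1 (deriv (g t)) r := by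
    have h3 := h1.fderiv_right (m := 1) le_rfl
    have : deriv (g t) = fun y => fderiv ℝ (g t) y 1 := by
      ext y; simp
    rw [this]
    exact h3.clm_apply contDiffAt_const
  exact h2.differentiableAt (by norm_num)

lemma C2_diff_t {T t r : ℝ} {g : ℝ → ℝ → ℝ} (h : C2On (Set.Ico 0 T) g) (ht : t ∈ Set.Ioo 0 T)
    (hr : 0 ≤ r) : DifferentiableAt ℝ (fun s => g s r) t :=
  ((C2_slice_t h hr).contDiffAt (Ico_mem_nhds ht.1 ht.2)).differentiableAt (by norm_num)

lemma C2_bd0 {T t1 : ℝ} {g : ℝ → ℝ → ℝ}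
    (h : ContinuousOn (fun p : ℝ × ℝ => g p.1 p.2) (Set.Ico 0 T ×ˢ Set.Ici (0:ℝ)))
    (ht1 : t1 < T) (A : ℝ) :
    ∃ C, 0 ≤ C ∧ ∀ t ∈ Set.Icc 0 t1, ∀ r ∈ Set.Icc 0 A, |g t r| ≤ C := by
  have hK : IsCompact (Set.Icc 0 t1 ×ˢ Set.Icc 0 A) := isCompact_Icc.prod isCompact_Icc
  obtain ⟨C, hC⟩ := hK.exists_bound_of_continuousOn (h.mono (Set.prod_mono
    (fun t ht => ⟨ht.1, ht.2.trans_lt ht1⟩) (fun r hr => hr.1)))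
  refine ⟨max C 0, le_max_right _ _, fun t ht r hr => (hC (t, r) ⟨ht, hr⟩).trans (le_max_left _ _)⟩

lemma C2_bd {T t1 : ℝ} {g : ℝ → ℝ → ℝ} (h : C2On (Set.Ico 0 T) g) (ht1 : t1 < T) (A : ℝ) :
    ∃ C, 0 ≤ C ∧ ∀ t ∈ Set.Ioc 0 t1, ∀ r ∈ Set.Ioc 0 A,
      |deriv (g t) r| ≤ C ∧ |deriv (fun s => g s r) t| ≤ C := by
  have hK : IsCompact (Set.Icc 0 t1 ×ˢ Set.Icc 0 A) := isCompact_Icc.prod isCompact_Icc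
  have hU : UniqueDiffOn ℝ (Set.Ico 0 T ×ˢ Set.Ici (0:ℝ)) :=
    (uniqueDiffOn_Ico 0 T).prod (uniqueDiffOn_Ici 0)
  have hc := ContDiffOn.continuousOn_fderivWithin h hU (by norm_num)
  obtain ⟨C, hC⟩ := hK.exists_bound_of_continuousOn (hc.mono (Set.prod_mono
    (fun t ht => ⟨ht.1, ht.2.trans_lt ht1⟩) (fun r hr => hr.1)))
  refine ⟨max C 0, le_max_right _ _, fun t ht r hr => ?_⟩
  have hn : Set.Ico 0 T ×ˢ Set.Ici (0:ℝ) ∈ 𝓝 ((t, r) : ℝ × ℝ) :=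
    prod_mem_nhds (Ico_mem_nhds ht.1 (ht.2.trans_lt ht1)) (Ici_mem_nhds hr.1)
  have hb := hC (t, r) ⟨⟨ht.1.le, ht.2⟩, ⟨hr.1.le, hr.2⟩⟩
  have hd : HasFDerivAt (fun p : ℝ × ℝ => g p.1 p.2)
      (fderivWithin ℝ (fun p : ℝ × ℝ => g p.1 p.2) (Set.Ico 0 T ×ˢ Set.Ici (0:ℝ)) (t, r)) (t, r) := by
    rw [fderivWithin_of_mem_nhds hn]
    exact ((ContDiffOn.contDiffAt h hn).differentiableAt (by norm_num)).hasFDerivAt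
  set L := fderivWithin ℝ (fun p : ℝ × ℝ => g p.1 p.2) (Set.Ico 0 T ×ˢ Set.Ici (0:ℝ)) (t, r)
  have e1 : HasDerivAt (g t) (L (0, 1)) r :=
    HasFDerivAt.comp_hasDerivAt r (f := fun r => (t, r)) (l := fun p : ℝ × ℝ => g p.1 p.2) hd
      ((hasDerivAt_const r t).prodMk (hasDerivAt_id r))
  have e2 : HasDerivAt (fun s => g s r) (L (1, 0)) t :=
    HasFDerivAt.comp_hasDerivAt t (f := fun t => (t, r)) (l := fun p : ℝ × ℝ => g p.1 p.2) hd
      ((hasDerivAt_id t).prodMk (hasDerivAt_const t r))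
  have n1 : ‖((0, 1) : ℝ × ℝ)‖ = 1 := by simp [Prod.norm_def]
  have n2 : ‖((1, 0) : ℝ × ℝ)‖ = 1 := by simp [Prod.norm_def]
  rw [e1.deriv, e2.deriv]
  constructor
  · exact ((L.le_opNorm _).trans (by rw [n1, mul_one]; exact hb)).trans (le_max_left _ _)
  · exact ((L.le_opNorm _).trans (by rw [n2, mul_one]; exact hb)).trans (le_max_left _ _)

/-- Derivative along a straight line in direction `(1, G1, G2)`. -/
lemma f_line {q T t : ℝ} {lam mu lamT e : ℝ → ℝ → ℝ} {f : ℝ → E3 → E3 → ℝ}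
    (hf : RegDist (Set.Ico 0 T) f) (hV : VlasovEq q (Set.Ico 0 T) lam mu lamT e f)
    (ht : t ∈ Set.Ioo 0 T) (x v G1 G2 : E3) :
    HasDerivAt (fun s : ℝ => f (t + s) (x + s • G1) (v + s • G2))
      (fderiv ℝ (fun y => f t y v) x (G1 - F1 lam mu t x v)
        + fderiv ℝ (fun u => f t x u) v (G2 - F2 q lam mu lamT e t x v)) 0 := by
  have hn : Set.Ico 0 T ×ˢ (Set.univ : Set (E3 × E3)) ∈ 𝓝 ((t, (x, v)) : ℝ × (E3 × E3)) :=
    prod_mem_nhds (Ico_mem_nhds ht.1 ht.2) univ_mem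
  have hd := ((hf.1.contDiffAt hn).differentiableAt (by norm_num)).hasFDerivAt
  set L := fderiv ℝ (fun p : ℝ × (E3 × E3) => f p.1 p.2.1 p.2.2) (t, (x, v))
  have hv := hV t ⟨ht.1.le, ht.2⟩ x v
  have e1 : HasDerivAt (fun s => f s x v) (L (1, (0, 0))) t :=
    HasFDerivAt.comp_hasDerivAt t (f := fun t => (t, (x, v)))
      (l := fun p : ℝ × (E3 × E3) => f p.1 p.2.1 p.2.2) hd
      ((hasDerivAt_id t).prodMk (hasDerivAt_const t (x, v)))
  have e2 : HasFDerivAt (fun y => f t y v)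
      (L.comp ((0 : E3 →L[ℝ] ℝ).prod ((ContinuousLinearMap.id ℝ E3).prod 0))) x :=
    HasFDerivAt.comp x (f := fun y => (t, (y, v)))
      (g := fun p : ℝ × (E3 × E3) => f p.1 p.2.1 p.2.2) hd
      ((hasFDerivAt_const t x).prodMk ((hasFDerivAt_id x).prodMk (hasFDerivAt_const v x)))
  have e3 : HasFDerivAt (fun u => f t x u)
      (L.comp ((0 : E3 →L[ℝ] ℝ).prod ((0 : E3 →L[ℝ] E3).prod (ContinuousLinearMap.id ℝ E3)))) v :=
    HasFDerivAt.comp v (f := fun u => (t, (x, u)))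
      (g := fun p : ℝ × (E3 × E3) => f p.1 p.2.1 p.2.2) hd
      ((hasFDerivAt_const t v).prodMk ((hasFDerivAt_const x v).prodMk (hasFDerivAt_id v)))
  have l1 : HasDerivAt (fun s : ℝ => t + s) 1 0 := by
    simpa using (hasDerivAt_id (0:ℝ)).const_add t
  have l2 : ∀ y G : E3, HasDerivAt (fun s : ℝ => y + s • G) G 0 := fun y G => by
    simpa using ((hasDerivAt_id (0:ℝ)).smul_const G).const_add y
  have hd' : HasFDerivAt (fun p : ℝ × (E3 × E3) => f p.1 p.2.1 p.2.2) L
      ((fun s : ℝ => (t + s, (x + s • G1, v + s • G2))) 0) := by simpa using hd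
  have e4 := HasFDerivAt.comp_hasDerivAt 0 (f := fun s : ℝ => (t + s, (x + s • G1, v + s • G2)))
      (l := fun p : ℝ × (E3 × E3) => f p.1 p.2.1 p.2.2) hd' (l1.prodMk ((l2 x G1).prodMk (l2 v G2)))
  refine HasDerivAt.congr_deriv e4 (Eq.symm ?_)
  rw [e1.deriv, e2.fderiv, e3.fderiv] at hv
  rw [e2.fderiv, e3.fderiv]
  simp only [ContinuousLinearMap.comp_apply, ContinuousLinearMap.prod_apply,
    ContinuousLinearMap.id_apply, ContinuousLinearMap.zero_apply] at hv ⊢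
  have : ((1, (G1, G2)) : ℝ × (E3 × E3)) = (1, (0, 0)) + (0, (F1 lam mu t x v, 0))
      + (0, (0, F2 q lam mu lamT e t x v)) + (0, (G1 - F1 lam mu t x v, 0))
      + (0, (0, G2 - F2 q lam mu lamT e t x v)) := by
    simp
  rw [this, map_add, map_add, map_add, map_add, hv, zero_add]

lemma f_cont_slice {T t : ℝ} {f : ℝ → E3 → E3 → ℝ}
    (hf : RegDist (Set.Ico 0 T) f) (ht : t ∈ Set.Ico 0 T) :
    ContDiff ℝ 1 (fun z : E3 × E3 => f t z.1 z.2) := by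
  rw [← contDiffOn_univ]
  have : ContDiffOn ℝ 1 (fun z : E3 × E3 => ((t, z) : ℝ × (E3 × E3))) Set.univ := by
    apply ContDiff.contDiffOn; fun_prop
  exact ContDiffOn.comp hf.1 this (fun r hr => ⟨ht, trivial⟩)

lemma f_grad_bd {T t1 : ℝ} {f : ℝ → E3 → E3 → ℝ}
    (hf : RegDist (Set.Ico 0 T) f) (ht1 : t1 < T) (R : ℝ) :
    ∃ C, 0 ≤ C ∧ ∀ t ∈ Set.Ioc 0 t1, ∀ x v : E3, ‖x‖ ≤ R → ‖v‖ ≤ R →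
      |f t x v| ≤ C ∧ ‖fderiv ℝ (fun y => f t y v) x‖ ≤ C ∧ ‖fderiv ℝ (fun u => f t x u) v‖ ≤ C := by
  have hK : IsCompact (Set.Icc 0 t1 ×ˢ (Metric.closedBall (0:E3) R ×ˢ Metric.closedBall (0:E3) R)) :=
    isCompact_Icc.prod ((isCompact_closedBall 0 R).prod (isCompact_closedBall 0 R))
  have hU : UniqueDiffOn ℝ (Set.Ico 0 T ×ˢ (Set.univ : Set (E3 × E3))) :=
    (uniqueDiffOn_Ico 0 T).prod uniqueDiffOn_univ
  have hc := ContDiffOn.continuousOn_fderivWithin hf.1 hU (by norm_num)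
  have hsub : Set.Icc 0 t1 ×ˢ (Metric.closedBall (0:E3) R ×ˢ Metric.closedBall (0:E3) R) ⊆
      Set.Ico 0 T ×ˢ (Set.univ : Set (E3 × E3)) := Set.prod_mono
    (fun t ht => ⟨ht.1, ht.2.trans_lt ht1⟩) (Set.subset_univ _)
  obtain ⟨C, hC⟩ := hK.exists_bound_of_continuousOn (hc.mono hsub)
  obtain ⟨C', hC'⟩ := hK.exists_bound_of_continuousOn (hf.1.continuousOn.mono hsub)
  refine ⟨max (max C C') 0, le_max_right _ _, fun t ht x v hx hv => ?_⟩
  have hn : Set.Ico 0 T ×ˢ (Set.univ : Set (E3 × E3)) ∈ 𝓝 ((t, (x, v)) : ℝ × (E3 × E3)) :=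
    prod_mem_nhds (Ico_mem_nhds ht.1 (ht.2.trans_lt ht1)) univ_mem
  have hm : (t, (x, v)) ∈ Set.Icc 0 t1 ×ˢ (Metric.closedBall (0:E3) R ×ˢ Metric.closedBall (0:E3) R) :=
    ⟨⟨ht.1.le, ht.2⟩, by simpa using hx, by simpa using hv⟩
  have hb := hC _ hm
  rw [fderivWithin_of_mem_nhds hn] at hb
  have hd := ((hf.1.contDiffAt hn).differentiableAt (by norm_num)).hasFDerivAt
  set L := fderiv ℝ (fun p : ℝ × (E3 × E3) => f p.1 p.2.1 p.2.2) (t, (x, v))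
  have e2 : HasFDerivAt (fun y => f t y v)
      (L.comp ((0 : E3 →L[ℝ] ℝ).prod ((ContinuousLinearMap.id ℝ E3).prod 0))) x :=
    HasFDerivAt.comp x (f := fun y => (t, (y, v)))
      (g := fun p : ℝ × (E3 × E3) => f p.1 p.2.1 p.2.2) hd
      ((hasFDerivAt_const t x).prodMk ((hasFDerivAt_id x).prodMk (hasFDerivAt_const v x)))
  have e3 : HasFDerivAt (fun u => f t x u)
      (L.comp ((0 : E3 →L[ℝ] ℝ).prod ((0 : E3 →L[ℝ] E3).prod (ContinuousLinearMap.id ℝ E3)))) v :=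
    HasFDerivAt.comp v (f := fun u => (t, (x, u)))
      (g := fun p : ℝ × (E3 × E3) => f p.1 p.2.1 p.2.2) hd
      ((hasFDerivAt_const t v).prodMk ((hasFDerivAt_const x v).prodMk (hasFDerivAt_id v)))
  rw [e2.fderiv, e3.fderiv]
  refine ⟨(hC' _ hm).trans ((le_max_right _ _).trans (le_max_left _ _)), ?_, ?_⟩
  · refine ContinuousLinearMap.opNorm_le_bound _ (le_max_right _ _) (fun y => ?_)
    have : ‖((0, (y, 0)) : ℝ × (E3 × E3))‖ = ‖y‖ := by simp [Prod.norm_def]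
    calc _ ≤ ‖L‖ * ‖((0, (y, 0)) : ℝ × (E3 × E3))‖ := L.le_opNorm _
      _ ≤ _ := by
        rw [this]; gcongr; exact hb.trans ((le_max_left _ _).trans (le_max_left _ _))
  · refine ContinuousLinearMap.opNorm_le_bound _ (le_max_right _ _) (fun y => ?_)
    have : ‖((0, (0, y)) : ℝ × (E3 × E3))‖ = ‖y‖ := by simp [Prod.norm_def]
    calc _ ≤ ‖L‖ * ‖((0, (0, y)) : ℝ × (E3 × E3))‖ := L.le_opNorm _
      _ ≤ _ := by
        rw [this]; gcongr; exact hb.trans ((le_max_left _ _).trans (le_max_left _ _))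

lemma pt_eq (r : ℝ) : pt r = r • pt 1 := by
  unfold pt; ext i; by_cases h : i = 0 <;> simp [h]

lemma norm_pt (r : ℝ) : ‖pt r‖ = |r| := by
  unfold pt; simp

lemma pt_hasDeriv (r : ℝ) : HasDerivAt pt (pt 1) r := by
  have : pt = fun r : ℝ => r • pt 1 := by ext1 r; exact pt_eq r
  rw [this]
  simpa using (hasDerivAt_id r).smul_const (pt 1)

lemma pt_cont : Continuous pt := by
  have : pt = fun r : ℝ => r • pt 1 := by ext1 r; exact pt_eq r
  rw [this]; fun_prop

/-- volume of the ball in velocity space -/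
def vb (P : ℝ) : ℝ := (volume (Metric.closedBall (0:E3) P)).toReal

lemma vb_nonneg (P : ℝ) : 0 ≤ vb P := ENNReal.toReal_nonneg

lemma integrable_of_supp {h : E3 → ℝ} {P : ℝ} (hc : Continuous h)
    (hs : ∀ v, P < ‖v‖ → h v = 0) : Integrable h := by
  apply hc.integrable_of_hasCompactSupport
  apply HasCompactSupport.of_support_subset_isCompact (isCompact_closedBall (0:E3) P)
  intro v hv
  simp only [Metric.mem_closedBall, dist_zero_right]
  by_contra hlt
  exact hv (hs v (not_le.1 hlt))

lemma vint_bound {h : E3 → ℝ} {P C : ℝ} (hs : ∀ v, P < ‖v‖ → h v = 0)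
    (hb : ∀ v, ‖v‖ ≤ P → |h v| ≤ C) : |∫ v, h v| ≤ C * vb P := by
  have h1 : ∫ v, h v = ∫ v in Metric.closedBall (0:E3) P, h v := by
    rw [setIntegral_eq_integral_of_forall_compl_eq_zero]
    intro v hv
    apply hs
    simpa using hv
  rw [h1, ← Real.norm_eq_abs]
  refine norm_setIntegral_le_of_norm_le_const (μ := volume) ?_ ?_
  · exact (isCompact_closedBall (0:E3) P).measure_lt_top
  · intro v hv
    exact hb v (by simpa using hv)

/-- difference of velocity moments -/
lemma vint_diff {psi h1 h2 : E3 → ℝ} {P W a : ℝ} (hpsi : Continuous psi) (hc1 : Continuous h1)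
    (hc2 : Continuous h2)
    (hs1 : ∀ v, P < ‖v‖ → h1 v = 0) (hs2 : ∀ v, P < ‖v‖ → h2 v = 0)
    (hW : ∀ v, ‖v‖ ≤ P → |psi v| ≤ W) (hW0 : 0 ≤ W) (ha : ∀ v, |h1 v - h2 v| ≤ a) :
    |(∫ v, psi v * h1 v) - ∫ v, psi v * h2 v| ≤ W * a * vb P := by
  rw [← MeasureTheory.integral_sub]
  · apply vint_bound
    · intro v hv; simp [hs1 v hv, hs2 v hv]
    · intro v hv
      rw [← mul_sub, abs_mul]
      exact mul_le_mul (hW v hv) (ha v) (abs_nonneg _) hW0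
  · exact integrable_of_supp (P := P) (by fun_prop) (fun v hv => by simp [hs1 v hv])
  · exact integrable_of_supp (P := P) (by fun_prop) (fun v hv => by simp [hs2 v hv])

lemma exists_supp {phi : E3 → E3 → ℝ} (hs : HasCompactSupport (fun z : E3 × E3 => phi z.1 z.2)) :
    ∃ P, 0 ≤ P ∧ ∀ x v, (P < ‖x‖ ∨ P < ‖v‖) → phi x v = 0 := by
  obtain ⟨P, hP⟩ := hs.isCompact.isBounded.exists_norm_le
  refine ⟨max P 0, le_max_right _ _, fun x v h => ?_⟩
  by_contra hne
  have := hP (x, v) (subset_tsupport _ hne)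
  rw [Prod.norm_def] at this
  simp only [sup_le_iff] at this
  rcases h with h | h
  · exact absurd (this.1.trans (le_max_left _ _)) (not_le.2 h)
  · exact absurd (this.2.trans (le_max_left _ _)) (not_le.2 h)

lemma vint_hasDeriv {phi : E3 → E3 → ℝ} {psi : E3 → ℝ}
    (hphi : ContDiff ℝ 1 (fun z : E3 × E3 => phi z.1 z.2))
    (hs : HasCompactSupport (fun z : E3 × E3 => phi z.1 z.2)) (hpsi : Continuous psi) (r : ℝ) :
    DifferentiableAt ℝ (fun r => ∫ v, psi v * phi (pt r) v) r := by
  obtain ⟨P, hP0, hP⟩ := exists_supp hs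
  have hc := hphi.continuous
  have hfc : Continuous (fderiv ℝ (fun z : E3 × E3 => phi z.1 z.2)) :=
    hphi.continuous_fderiv (by norm_num)
  obtain ⟨C, hC⟩ := (hs.fderiv ℝ).exists_bound_of_continuous hfc
  obtain ⟨W, hW⟩ := (isCompact_closedBall (0:E3) P).exists_bound_of_continuousOn hpsi.continuousOn
  set F' : ℝ → E3 → ℝ := fun r v =>
    psi v * fderiv ℝ (fun z : E3 × E3 => phi z.1 z.2) (pt r, v) (pt 1, 0) with hF'
  have hderiv : ∀ v r, HasDerivAt (fun r => psi v * phi (pt r) v) (F' r v) r := by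
    intro v r
    have h1 := ((hphi.differentiable (by norm_num)) (pt r, v)).hasFDerivAt
    exact (HasFDerivAt.comp_hasDerivAt r (f := fun r => (pt r, v))
      (l := fun z : E3 × E3 => phi z.1 z.2) h1
      ((pt_hasDeriv r).prodMk (hasDerivAt_const r v))).const_mul _
  have hzero : ∀ v r, P < ‖v‖ → F' r v = 0 := by
    intro v r hv
    have h1 := hderiv v r
    have h2 : (fun r => psi v * phi (pt r) v) = fun _ => 0 := by
      ext r; rw [hP _ _ (Or.inr hv), mul_zero]
    rw [h2] at h1
    exact h1.unique (hasDerivAt_const r (0:ℝ))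
  refine (hasDerivAt_integral_of_dominated_loc_of_deriv_le (μ := volume)
    (F := fun r v => psi v * phi (pt r) v) (F' := F') (x₀ := r) (s := Set.univ)
    (bound := (Metric.closedBall (0:E3) P).indicator (fun _ => W * (C * ‖((pt 1, 0) : E3 × E3)‖)))
    univ_mem ?_ ?_ ?_ ?_ ?_ ?_).2.differentiableAt
  · refine Eventually.of_forall fun r => Continuous.aestronglyMeasurable ?_
    have : Continuous fun v => phi (pt r) v := hc.comp (Continuous.prodMk_right (pt r))
    fun_prop
  · refine integrable_of_supp (P := P) ?_ (fun v hv => by rw [hP _ _ (Or.inr hv), mul_zero])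
    have : Continuous fun v => phi (pt r) v := hc.comp (Continuous.prodMk_right (pt r))
    fun_prop
  · refine Continuous.aestronglyMeasurable ?_
    have : Continuous fun v => fderiv ℝ (fun z : E3 × E3 => phi z.1 z.2) (pt r, v) :=
      hfc.comp (Continuous.prodMk_right (pt r))
    exact hpsi.mul (this.clm_apply continuous_const)
  · refine Eventually.of_forall fun v r _ => ?_
    by_cases hv : v ∈ Metric.closedBall (0:E3) P
    · rw [Set.indicator_of_mem hv, hF', norm_mul]
      have hW0 : 0 ≤ W := (norm_nonneg _).trans (hW v hv)
      gcongr
      · exact hW v hv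
      · refine (ContinuousLinearMap.le_opNorm _ _).trans ?_
        gcongr
        exact hC _
    · rw [Set.indicator_of_notMem hv, hzero v r (by simpa using hv), norm_zero]
  · rw [integrable_indicator_iff Metric.isClosed_closedBall.measurableSet]
    exact integrableOn_const (isCompact_closedBall (0:E3) P).measure_lt_top.ne
  · exact Eventually.of_forall fun v r _ => hderiv v r

lemma vint_cont {phi : E3 → E3 → ℝ} {psi : E3 → ℝ}
    (hphi : ContDiff ℝ 1 (fun z : E3 × E3 => phi z.1 z.2))
    (hs : HasCompactSupport (fun z : E3 × E3 => phi z.1 z.2)) (hpsi : Continuous psi) :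
    Continuous (fun r => ∫ v, psi v * phi (pt r) v) :=
  continuous_iff_continuousAt.2 fun r => (vint_hasDeriv hphi hs hpsi r).continuousAt

lemma junk_ode_diff {h : ℝ → ℝ} {r : ℝ} (hc : ContinuousAt h r)
    (h2 : DifferentiableAt ℝ (fun s => h s ^ 2) r) (hr : h r ≠ 0) : DifferentiableAt ℝ h r := by
  have h3 : DifferentiableAt ℝ (fun s => √(h s ^ 2)) r := h2.sqrt (by positivity)
  rcases lt_or_gt_of_ne hr with hlt | hgt
  · have : h =ᶠ[𝓝 r] fun s => -√(h s ^ 2) := by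
      filter_upwards [hc.eventually_lt continuousAt_const hlt] with s hs
      rw [Real.sqrt_sq_eq_abs, abs_of_neg hs, neg_neg]
    exact h3.neg.congr_of_eventuallyEq this
  · have : h =ᶠ[𝓝 r] fun s => √(h s ^ 2) := by
      filter_upwards [continuousAt_const.eventually_lt hc hgt] with s hs
      rw [Real.sqrt_sq_eq_abs, abs_of_pos hs]
    exact h3.congr_of_eventuallyEq this

lemma junk_ode {h G : ℝ → ℝ} (hc : ContinuousOn h (Set.Ici 0)) (h0 : h 0 = 0)
    (hG : ContinuousOn G (Set.Ici 0)) (hG0 : ∀ r, 0 ≤ r → 0 ≤ G r)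
    (hd : ∀ r, 0 < r → deriv h r = G r)
    (h2 : ∀ r, 0 < r → DifferentiableAt ℝ (fun s => h s ^ 2) r) :
    ∀ r, 0 ≤ r → h r = ∫ s in (0:ℝ)..r, G s := by
  have hca : ∀ r, 0 < r → ContinuousAt h r := fun r hr => hc.continuousAt (Ici_mem_nhds hr)
  have hD : ∀ r, 0 < r → h r ≠ 0 → HasDerivAt h (G r) r := by
    intro r hr hne
    rw [← hd r hr]
    exact (junk_ode_diff (hca r hr) (h2 r hr) hne).hasDerivAt
  have key : ∀ r, 0 ≤ r → ∃ a, 0 ≤ a ∧ a ≤ r ∧ h a = 0 ∧ h r = ∫ s in a..r, G s := by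
    intro r hr
    have hK : IsCompact (Set.Icc 0 r ∩ h ⁻¹' {0}) := by
      apply IsCompact.of_isClosed_subset isCompact_Icc _ Set.inter_subset_left
      exact (hc.mono Set.Icc_subset_Ici_self).preimage_isClosed_of_isClosed isClosed_Icc
        isClosed_singleton
    obtain ⟨a, ⟨⟨ha0, har⟩, haz⟩, hmax⟩ := hK.exists_isGreatest ⟨0, ⟨le_rfl, hr⟩, h0⟩
    refine ⟨a, ha0, har, haz, ?_⟩
    have haz' : h a = 0 := haz
    rw [integral_eq_sub_of_hasDerivAt_of_le har (f := h), haz', sub_zero]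
    · exact hc.mono (fun s hs => ha0.trans hs.1)
    · intro s hs
      apply hD s (ha0.trans_lt hs.1)
      intro hz
      exact absurd (hmax ⟨⟨ha0.trans hs.1.le, hs.2.le⟩, hz⟩) (not_le.2 hs.1)
    · apply ContinuousOn.intervalIntegrable
      rw [Set.uIcc_of_le har]
      exact hG.mono (fun s hs => ha0.trans hs.1)
  have hpos : ∀ r, 0 ≤ r → 0 ≤ h r := by
    intro r hr
    obtain ⟨a, ha0, har, -, he⟩ := key r hr
    rw [he]
    exact integral_nonneg har (fun s hs => hG0 s (ha0.trans hs.1))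
  have hmono : MonotoneOn (fun s => h s ^ 2) (Set.Ici 0) := by
    apply monotoneOn_of_deriv_nonneg (convex_Ici 0) (hc.pow 2)
    · rw [interior_Ici]
      exact fun r hr => (h2 r hr).differentiableWithinAt
    · rw [interior_Ici]
      intro r hr
      change 0 ≤ deriv (fun s => h s ^ 2) r
      by_cases hz : h r = 0
      · have : IsLocalMin (fun s => h s ^ 2) r :=
          Eventually.of_forall fun s => by
            have := sq_nonneg (h s)
            simpa [hz] using this
        rw [this.deriv_eq_zero]
      · have := ((hD r hr hz).pow 2).deriv
        have e : (h ^ 2) = fun s => h s ^ 2 := rfl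
        rw [e] at this
        rw [this]
        have h1 := hpos r (le_of_lt hr)
        have h3 := hG0 r (le_of_lt hr)
        positivity
  intro r hr
  obtain ⟨a, ha0, har, haz, he⟩ := key r hr
  have hz : ∀ s, 0 ≤ s → s ≤ a → h s = 0 := by
    intro s hs hsa
    have := hmono hs ha0 hsa
    simp only [haz] at this
    nlinarith [sq_nonneg (h s)]
  have hGz : ∀ s ∈ Set.Ioo 0 a, G s = 0 := by
    intro s hs
    rw [← hd s hs.1]
    have : h =ᶠ[𝓝 s] fun _ => 0 := by
      filter_upwards [Ioo_mem_nhds hs.1 hs.2] with u hu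
      exact hz u hu.1.le hu.2.le
    rw [this.deriv_eq, deriv_const]
  have hi : ∀ x y, 0 ≤ x → 0 ≤ y → IntervalIntegrable G volume x y := by
    intro x y hx hy
    apply ContinuousOn.intervalIntegrable
    exact hG.mono (fun s hs => (le_inf hx hy).trans hs.1)
  rw [← integral_add_adjacent_intervals (hi 0 a le_rfl ha0) (hi a r ha0 hr), ← he]
  have : ∫ s in (0:ℝ)..a, G s = 0 := by
    rw [integral_of_le ha0, integral_Ioc_eq_integral_Ioo,
      setIntegral_congr_fun measurableSet_Ioo hGz]
    simp
  rw [this, zero_add]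

lemma rho_eq {lam e : ℝ → ℝ → ℝ} {f : ℝ → E3 → E3 → ℝ} (t r : ℝ) :
    rho lam e f t r = (∫ v : E3, w v * f t (pt r) v)
      + (1/2) * (Real.exp (lam t r) * e t r) ^ 2 := by
  unfold rho
  rw [mul_pow, ← Real.exp_nat_mul]; push_cast; ring

lemma maxwell_slice {q T t : ℝ} {lam mu e : ℝ → ℝ → ℝ} {f : ℝ → E3 → E3 → ℝ}
    (hs : RegularSolution q (Set.Ico 0 T) lam mu e f) (ht : t ∈ Set.Ico 0 T) :
    ∀ r, 0 ≤ r → r ^ 2 * (Real.exp (lam t r) * e t r)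
      = ∫ s in (0:ℝ)..r, q * s ^ 2 * (Real.exp (lam t s) * Mch f t s) := by
  obtain ⟨⟨hlam, hmu, -⟩, ⟨hec, -⟩, hf, h26, -, -, -, -, h11, -⟩ := hs
  have hphi := f_cont_slice hf ht
  have hcs := hf.2.2.2 t ht
  have hlc : ContinuousOn (lam t) (Set.Ici 0) := (C2_slice_r hlam ht).continuousOn
  have hecs : ContinuousOn (e t) (Set.Ici 0) :=
    hec.comp (f := fun r => (t, r)) (by fun_prop) (fun r hr => ⟨ht, hr⟩)
  have hMc : Continuous (Mch f t) := by
    have := vint_cont (psi := fun _ => 1) hphi hcs continuous_const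
    simp only [one_mul] at this
    exact this
  have hM0 : ∀ r, 0 ≤ Mch f t r := fun r => integral_nonneg (fun v => hf.2.1 t ht _ _)
  have hWd : ∀ r, DifferentiableAt ℝ (fun r => ∫ v, w v * f t (pt r) v) r :=
    vint_hasDeriv hphi hcs w_cont
  set h : ℝ → ℝ := fun s => s ^ 2 * Real.exp (lam t s) * e t s with hh
  set G : ℝ → ℝ := fun s => q * s ^ 2 * Real.exp (lam t s) * Mch f t s with hGdef
  have hhc : ContinuousOn h (Set.Ici 0) := by
    exact ((continuousOn_id.pow 2).mul hlc.rexp).mul hecs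
  have hGc : ContinuousOn G (Set.Ici 0) := by
    exact (((continuousOn_const.mul (continuousOn_id.pow 2))).mul hlc.rexp).mul hMc.continuousOn
  have hd2 : ∀ r, 0 < r → DifferentiableAt ℝ (fun s => h s ^ 2) r := by
    intro r hr
    have h1 := C2_diff_r hlam ht hr
    have h2 := C2_diff_r2 hlam ht hr
    have h3 := hWd r
    have : (fun s => h s ^ 2) =ᶠ[𝓝 r] fun s => s ^ 2 / (4 * π) *
        (Real.exp (-2 * lam t s) * (2 * s * deriv (lam t) s - 1) + 1
          - 8 * π * s ^ 2 * ∫ v, w v * f t (pt s) v) := by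
      filter_upwards [Ioi_mem_nhds hr] with s hs
      rw [h26 t ht s (le_of_lt hs), rho_eq, hh]
      have := Real.pi_pos
      field_simp
      ring
    refine DifferentiableAt.congr_of_eventuallyEq ?_ this
    fun_prop
  have hd : ∀ r, 0 < r → deriv h r = G r := fun r hr => h11 t ht r hr.le
  have hfin : ∀ r, 0 ≤ r → h r = ∫ s in (0:ℝ)..r, G s := by
    rcases le_total 0 q with hq | hq
    · exact junk_ode hhc (by simp [hh]) hGc
        (fun r hr => by have := hM0 r; simp only [hGdef]; positivity) hd hd2
    · have := junk_ode (h := fun s => - h s) (G := fun s => - G s) hhc.neg (by simp [hh]) hGc.neg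
        (fun r hr => by
          have := hM0 r
          have h2 : 0 ≤ -q := by linarith
          have : - G r = (-q) * r ^ 2 * Real.exp (lam t r) * Mch f t r := by
            simp only [hGdef]; ring
          rw [this]; positivity) (fun r hr => by rw [deriv.fun_neg, hd r hr]) (by simpa using hd2)
      intro r hr
      have := this r hr
      rw [intervalIntegral.integral_neg] at this
      linarith
  intro r hr
  have := hfin r hr
  simp only [hh, hGdef] at this
  rw [← mul_assoc, this]
  congr 1; ext s; ring

lemma prs_eq {lam e : ℝ → ℝ → ℝ} {f : ℝ → E3 → E3 → ℝ} (t r : ℝ) :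
    prs lam e f t r = (∫ v : E3, (v 0) ^ 2 / w v * f t (pt r) v)
      - (1/2) * (Real.exp (lam t r) * e t r) ^ 2 := by
  unfold prs
  rw [mul_pow, ← Real.exp_nat_mul]; push_cast; ring

lemma sum_deriv {q T t : ℝ} {lam mu e : ℝ → ℝ → ℝ} {f : ℝ → E3 → E3 → ℝ}
    (hs : RegularSolution q (Set.Ico 0 T) lam mu e f) (ht : t ∈ Set.Ico 0 T) {r : ℝ} (hr : 0 < r) :
    HasDerivAt (fun s => lam t s + mu t s) (4 * π * r * (Real.exp (2 * lam t r) *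
      ((∫ v : E3, w v * f t (pt r) v) + ∫ v : E3, (v 0) ^ 2 / w v * f t (pt r) v))) r := by
  obtain ⟨⟨hlam, hmu, -⟩, -, hf, h26, -, h28, -⟩ := hs
  have h1 := (C2_diff_r hlam ht hr).hasDerivAt
  have h2 := (C2_diff_r hmu ht hr).hasDerivAt
  refine (h1.add h2).congr_deriv ?_
  have e1 := h26 t ht r hr.le
  have e2 := h28 t ht r hr.le
  rw [rho_eq] at e1
  rw [prs_eq] at e2
  have e3 : Real.exp (2 * lam t r) * Real.exp (-2 * lam t r) = 1 := by
    rw [← Real.exp_add]; simp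
  set A := ∫ v : E3, w v * f t (pt r) v
  set B := ∫ v : E3, (v 0) ^ 2 / w v * f t (pt r) v
  have : (2 * r) * (deriv (lam t) r + deriv (mu t) r) =
      (2 * r) * (4 * π * r * (Real.exp (2 * lam t r) * (A + B))) := by
    calc _ = Real.exp (2 * lam t r) * Real.exp (-2 * lam t r) *
          ((2 * r) * (deriv (lam t) r + deriv (mu t) r)) := by rw [e3, one_mul]
      _ = Real.exp (2 * lam t r) * ((Real.exp (-2 * lam t r) * (2 * r * deriv (lam t) r - 1) + 1) +
          (Real.exp (-2 * lam t r) * (2 * r * deriv (mu t) r + 1) - 1)) := by ring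
      _ = _ := by rw [e1, e2]; ring
  exact mul_left_cancel₀ (by positivity) this

lemma lam_nonneg {q T t : ℝ} {lam mu e : ℝ → ℝ → ℝ} {f : ℝ → E3 → E3 → ℝ}
    (hs : RegularSolution q (Set.Ico 0 T) lam mu e f) (ht : t ∈ Set.Ico 0 T) {r : ℝ} (hr : 0 ≤ r) :
    0 ≤ lam t r := by
  obtain ⟨⟨hlam, hmu, -, -, hl0, -⟩, -, hf, h26, -, h28, -⟩ := hs
  rcases hr.eq_or_lt with rfl | hr
  · rw [hl0 t ht]
  have hlc : ContinuousOn (lam t) (Set.Ici 0) := (C2_slice_r hlam ht).continuousOn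
  have hd : ∀ s, 0 < s → HasDerivAt (fun s => s * (1 - Real.exp (-2 * lam t s)))
      (8 * π * s ^ 2 * rho lam e f t s) s := by
    intro s hs
    have h1 := (C2_diff_r hlam ht hs).hasDerivAt
    have h2 := (hasDerivAt_id s).mul (((h1.const_mul (-2)).exp).const_sub 1)
    refine h2.congr_deriv ?_
    rw [← h26 t ht s hs.le]; simp only [id]; ring
  have hm : MonotoneOn (fun s => s * (1 - Real.exp (-2 * lam t s))) (Set.Ici 0) := by
    apply monotoneOn_of_deriv_nonneg (convex_Ici 0)
    · exact continuousOn_id.mul (continuousOn_const.sub (continuousOn_const.mul hlc).rexp)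
    · rw [interior_Ici]
      exact fun s hs => (hd s hs).differentiableAt.differentiableWithinAt
    · rw [interior_Ici]
      intro s hs
      rw [(hd s hs).deriv, rho_eq]
      have : 0 ≤ ∫ v : E3, w v * f t (pt s) v :=
        integral_nonneg (fun v => mul_nonneg (w_pos v).le (hf.2.1 t ht _ _))
      positivity
  have h1 := hm (Set.self_mem_Ici) (Set.mem_Ici.2 hr.le) hr.le
  simp only [zero_mul] at h1
  have h2 := nonneg_of_mul_nonneg_right h1 hr
  have h3 : Real.exp (-2 * lam t r) ≤ 1 := by linarith
  rw [Real.exp_le_one_iff] at h3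
  linarith

lemma sum_mono {q T t : ℝ} {lam mu e : ℝ → ℝ → ℝ} {f : ℝ → E3 → E3 → ℝ}
    (hs : RegularSolution q (Set.Ico 0 T) lam mu e f) (ht : t ∈ Set.Ico 0 T) :
    MonotoneOn (fun s => lam t s + mu t s) (Set.Ici 0) := by
  have hs' := hs
  obtain ⟨⟨hlam, hmu, -, -, hl0, -⟩, -, hf, -⟩ := hs'
  apply monotoneOn_of_deriv_nonneg (convex_Ici 0)
  · exact (C2_slice_r hlam ht).continuousOn.add (C2_slice_r hmu ht).continuousOn
  · rw [interior_Ici]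
    exact fun s h => (sum_deriv hs ht h).differentiableAt.differentiableWithinAt
  · rw [interior_Ici]
    intro s h
    rw [(sum_deriv hs ht h).deriv]
    have : 0 ≤ ∫ v : E3, w v * f t (pt s) v :=
        integral_nonneg (fun v => mul_nonneg (w_pos v).le (hf.2.1 t ht _ _))
    have : 0 ≤ ∫ v : E3, (v 0) ^ 2 / w v * f t (pt s) v :=
        integral_nonneg (fun v => mul_nonneg (div_nonneg (sq_nonneg _) (w_pos v).le)
          (hf.2.1 t ht _ _))
    have : 0 < s := h
    positivity

lemma sum_nonpos {q T t : ℝ} {lam mu e : ℝ → ℝ → ℝ} {f : ℝ → E3 → E3 → ℝ}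
    (hs : RegularSolution q (Set.Ico 0 T) lam mu e f) (ht : t ∈ Set.Ico 0 T) {r : ℝ} (hr : 0 ≤ r) :
    lam t r + mu t r ≤ 0 := by
  have hm := sum_mono hs ht
  have hl : Tendsto (fun s => lam t s + mu t s) atTop (𝓝 (0 + 0)) :=
    (hs.1.2.2.1 t ht).add (hs.1.2.2.2.1 t ht)
  rw [add_zero] at hl
  refine ge_of_tendsto hl ?_
  filter_upwards [eventually_ge_atTop r] with s hs
  exact hm (Set.mem_Ici.2 hr) (Set.mem_Ici.2 (hr.trans hs)) hs

/-- outside the support of the matter, `lam + mu = 0`. -/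
lemma sum_zero {q T t R : ℝ} {lam mu e : ℝ → ℝ → ℝ} {f : ℝ → E3 → E3 → ℝ}
    (hs : RegularSolution q (Set.Ico 0 T) lam mu e f) (ht : t ∈ Set.Ico 0 T) (hR : 0 ≤ R)
    (hsupp : ∀ x v, R < ‖x‖ → f t x v = 0) :
    lam t R + mu t R = 0 := by
  have hs' := hs
  obtain ⟨⟨hlam, hmu, -, -, hl0, -⟩, -, hf, -⟩ := hs'
  have hl : Tendsto (fun s => lam t s + mu t s) atTop (𝓝 (0 + 0)) :=
    (hs.1.2.2.1 t ht).add (hs.1.2.2.2.1 t ht)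
  rw [add_zero] at hl
  have hanti : AntitoneOn (fun s => lam t s + mu t s) (Set.Ici R) := by
    apply antitoneOn_of_deriv_nonpos (convex_Ici R)
    · exact ((C2_slice_r hlam ht).continuousOn.add (C2_slice_r hmu ht).continuousOn).mono
        (Set.Ici_subset_Ici.2 hR)
    · rw [interior_Ici]
      exact fun s h => (sum_deriv hs ht (hR.trans_lt h)).differentiableAt.differentiableWithinAt
    · rw [interior_Ici]
      intro s h
      rw [(sum_deriv hs ht (hR.trans_lt h)).deriv]
      have hz : ∀ v, f t (pt s) v = 0 := fun v => hsupp _ _ (by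
        rw [norm_pt]; exact (Set.mem_Ioi.1 h).trans_le (le_abs_self s))
      simp [hz]
  refine le_antisymm (sum_nonpos hs ht hR) ?_
  refine le_of_tendsto hl ?_
  filter_upwards [eventually_ge_atTop R] with s hs
  exact hanti Set.self_mem_Ici hs hs

/-- time derivative of `lam` -/
abbrev ldot (lam : ℝ → ℝ → ℝ) : ℝ → ℝ → ℝ := fun t r => deriv (fun s => lam s r) t

lemma left_max {h : ℝ → ℝ} {d : ℝ} (hd : HasDerivAt h d 0)
    (hm : ∀ᶠ s in 𝓝[<] (0:ℝ), h s ≤ h 0) : 0 ≤ d := by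
  have h1 : Tendsto (slope h 0) (𝓝[<] (0:ℝ)) (𝓝 d) :=
    (hasDerivAt_iff_tendsto_slope.1 hd).mono_left
      (nhdsWithin_mono (0:ℝ) (fun s hs => ne_of_lt (Set.mem_Iio.1 hs)))
  refine ge_of_tendsto h1 ?_
  filter_upwards [hm, self_mem_nhdsWithin] with s hs hneg
  have hneg' : s < 0 := hneg
  rw [slope_def_field]
  exact div_nonneg_of_nonpos (by linarith) (by linarith)

lemma F1_norm_le {q T t : ℝ} {lam mu e : ℝ → ℝ → ℝ} {f : ℝ → E3 → E3 → ℝ}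
    (hs : RegularSolution q (Set.Ico 0 T) lam mu e f) (ht : t ∈ Set.Ico 0 T) (x v : E3) :
    ‖F1 lam mu t x v‖ ≤ 1 := by
  have h1 := lam_nonneg hs ht (norm_nonneg x)
  have h2 := sum_nonpos hs ht (norm_nonneg x)
  have h3 : Real.exp (mu t ‖x‖ - lam t ‖x‖) ≤ 1 := Real.exp_le_one_iff.2 (by linarith)
  unfold F1
  rw [norm_smul, Real.norm_eq_abs, abs_of_pos (div_pos (Real.exp_pos _) (w_pos v)),
    div_mul_eq_mul_div, div_le_one (w_pos v)]
  calc _ ≤ 1 * ‖v‖ := by gcongr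
    _ ≤ _ := by rw [one_mul]; exact norm_le_w v

lemma norm_radial {x : E3} (hx : x ≠ 0) (a : ℝ) : ‖(a / ‖x‖) • x‖ = |a| := by
  have : ‖x‖ ≠ 0 := norm_ne_zero_iff.2 hx
  rw [norm_smul, Real.norm_eq_abs, abs_div, abs_norm]
  field_simp

lemma inner_div_le (x v : E3) : |(inner ℝ x v : ℝ) / ‖x‖| ≤ ‖v‖ := by
  by_cases hx : x = 0
  · simp [hx]
  have : 0 < ‖x‖ := norm_pos_iff.2 hx
  rw [abs_div, abs_norm, div_le_iff₀ this, mul_comm]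
  exact abs_real_inner_le_norm x v

lemma F2_norm_le {q T t1 : ℝ} {lam mu e : ℝ → ℝ → ℝ} {f : ℝ → E3 → E3 → ℝ}
    (hs : RegularSolution q (Set.Ico 0 T) lam mu e f) (ht1 : t1 < T) (A : ℝ) :
    ∃ C, 0 ≤ C ∧ ∀ t ∈ Set.Ioc 0 t1, ∀ x v, ‖x‖ ≤ A →
      ‖F2 q lam mu (ldot lam) e t x v‖ ≤ C * w v := by
  obtain ⟨C1, hC1, h1⟩ := C2_bd hs.1.1 ht1 A
  obtain ⟨C2, hC2, h2⟩ := C2_bd hs.1.2.1 ht1 A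
  obtain ⟨C3, hC3, h3⟩ := C2_bd0 hs.2.1.1 ht1 A
  refine ⟨C1 + C2 + |q| * C3, by positivity, fun t ht x v hx => ?_⟩
  have htT : t ∈ Set.Ico 0 T := ⟨ht.1.le, ht.2.trans_lt ht1⟩
  have hw := one_le_w v
  by_cases hx0 : x = 0
  · simp only [F2, hx0, if_true, norm_zero]; positivity
  have hxp : 0 < ‖x‖ := norm_pos_iff.2 hx0
  simp only [F2, hx0, if_false]
  rw [norm_radial hx0, abs_neg]
  have l1 := lam_nonneg hs htT (norm_nonneg x)
  have l2 := sum_nonpos hs htT (norm_nonneg x)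
  have l3 : Real.exp (mu t ‖x‖ - lam t ‖x‖) ≤ 1 := Real.exp_le_one_iff.2 (by linarith)
  have l4 : Real.exp (mu t ‖x‖ + lam t ‖x‖) ≤ 1 := Real.exp_le_one_iff.2 (by linarith)
  have b1 : |ldot lam t ‖x‖ * ((inner ℝ x v : ℝ) / ‖x‖)| ≤ C1 * w v := by
    rw [abs_mul]
    exact mul_le_mul (h1 t ht _ ⟨hxp, hx⟩).2 ((inner_div_le x v).trans (norm_le_w v))
      (abs_nonneg _) hC1
  have b2 : |Real.exp (mu t ‖x‖ - lam t ‖x‖) * deriv (mu t) ‖x‖ * w v| ≤ C2 * w v := by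
    rw [abs_mul, abs_mul, abs_of_pos (w_pos v), abs_of_pos (Real.exp_pos _)]
    gcongr
    calc _ ≤ 1 * C2 := by gcongr; exact (h2 t ht _ ⟨hxp, hx⟩).1
      _ = _ := one_mul _
  have b3 : |q * Real.exp (mu t ‖x‖ + lam t ‖x‖) * e t ‖x‖| ≤ |q| * C3 * w v := by
    rw [abs_mul, abs_mul, abs_of_pos (Real.exp_pos _)]
    have := h3 t ⟨ht.1.le, ht.2⟩ _ ⟨hxp.le, hx⟩
    calc _ ≤ |q| * 1 * C3 := by gcongr
      _ = |q| * C3 * 1 := by ring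
      _ ≤ _ := by gcongr
  calc _ ≤ C1 * w v + C2 * w v + |q| * C3 * w v := by
        refine (abs_sub _ _).trans (add_le_add ((abs_add_le _ _).trans (add_le_add b1 b2)) b3)
    _ = _ := by ring

lemma supp_lemma {q T t1 A C : ℝ} {lam mu e : ℝ → ℝ → ℝ} {f : ℝ → E3 → E3 → ℝ}
    (hs : RegularSolution q (Set.Ico 0 T) lam mu e f) (ht1 : t1 < T) (hC0 : 0 ≤ C)
    (hC : ∀ t ∈ Set.Ioc 0 t1, ∀ x v, ‖x‖ ≤ A → ‖F2 q lam mu (ldot lam) e t x v‖ ≤ C * w v)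
    (sg : ℝ → E3 → E3 → ℝ) (hsgc : Continuous (fun p : ℝ × (E3 × E3) => sg p.1 p.2.1 p.2.2))
    (hsg : ∀ t ∈ Set.Ioc 0 t1, ∀ x v, ‖x‖ ≤ A → ∃ d, d ≤ 0 ∧
      HasDerivAt (fun s : ℝ => sg (t + s) (x + s • F1 lam mu t x v)
        (v + s • F2 q lam mu (ldot lam) e t x v)) d 0)
    (h0 : ∀ x v, 0 < sg 0 x v → f 0 x v = 0) :
    ∀ t ∈ Set.Icc 0 t1, ∀ x v, t + w x < A → 0 < sg t x v → f t x v = 0 := by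
  intro t2 ht2 x2 v2 hA hpos
  by_contra hne
  have hfc := hs.2.2.1.1.continuousOn
  have hf0 := hs.2.2.1.2.1
  have hfpos : 0 < f t2 x2 v2 :=
    lt_of_le_of_ne (hf0 t2 ⟨ht2.1, ht2.2.trans_lt ht1⟩ _ _) (Ne.symm hne)
  set B : ℝ := Real.exp (C * t1) * (w v2 + 1) with hB
  set s2 : ℝ → E3 → ℝ := fun t x => A - t - w x with hs2
  set s3 : ℝ → E3 → ℝ := fun t v => B * Real.exp (-(C * t)) - w v with hs3
  have hBpos : 0 < B := by have := w_pos v2; positivity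
  have wc := w_cont
  have c2 : Continuous (fun p : ℝ × (E3 × E3) => s2 p.1 p.2.1) := by fun_prop
  have c3 : Continuous (fun p : ℝ × (E3 × E3) => s3 p.1 p.2.2) := by fun_prop
  set Om : Set (ℝ × (E3 × E3)) := {p | p.1 ∈ Set.Icc 0 t1 ∧ 0 ≤ sg p.1 p.2.1 p.2.2 ∧
    0 ≤ s2 p.1 p.2.1 ∧ 0 ≤ s3 p.1 p.2.2} with hOm
  have hcl : IsClosed Om := by
    refine (isClosed_Icc.preimage continuous_fst).inter ((isClosed_le continuous_const hsgc).inter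
      ((isClosed_le continuous_const c2).inter (isClosed_le continuous_const c3)))
  have hnx : ∀ p ∈ Om, ‖p.2.1‖ ≤ A := by
    intro p hp
    have h1 : 0 ≤ A - p.1 - w p.2.1 := hp.2.2.1
    have := norm_le_w p.2.1
    linarith [hp.1.1]
  have hnv : ∀ p ∈ Om, ‖p.2.2‖ ≤ B := by
    intro p hp
    have h1 : 0 ≤ B * Real.exp (-(C * p.1)) - w p.2.2 := hp.2.2.2
    have := norm_le_w p.2.2
    have h2 : Real.exp (-(C * p.1)) ≤ 1 := Real.exp_le_one_iff.2 (by
      have := mul_nonneg hC0 hp.1.1; linarith)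
    nlinarith
  have hcomp : IsCompact Om := by
    refine IsCompact.of_isClosed_subset
      ((isCompact_Icc (a := (0:ℝ)) (b := t1)).prod ((isCompact_closedBall (0:E3) A).prod (isCompact_closedBall (0:E3) B)))
      hcl ?_
    intro p hp
    exact ⟨hp.1, by simpa using hnx p hp, by simpa using hnv p hp⟩
  set Phi : ℝ × (E3 × E3) → ℝ := fun p => f p.1 p.2.1 p.2.2 *
    (sg p.1 p.2.1 p.2.2 * s2 p.1 p.2.1 * s3 p.1 p.2.2 * Real.exp (-p.1)) with hPhi
  have hPc : ContinuousOn Phi Om := by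
    refine ContinuousOn.mul (hfc.mono fun p hp => ⟨⟨hp.1.1, hp.1.2.trans_lt ht1⟩, trivial⟩) ?_
    apply Continuous.continuousOn
    fun_prop
  have hm2 : 0 < s2 t2 x2 := by simp only [hs2]; linarith
  have hm3 : 0 < s3 t2 v2 := by
    simp only [hs3, hB]
    have : Real.exp (C * t1) * (w v2 + 1) * Real.exp (-(C * t2))
        = Real.exp (C * (t1 - t2)) * (w v2 + 1) := by
      rw [mul_right_comm, ← Real.exp_add]; ring_nf
    rw [this]
    have h1 : 1 ≤ Real.exp (C * (t1 - t2)) :=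
      Real.one_le_exp (mul_nonneg hC0 (by linarith [ht2.2]))
    have := w_pos v2
    nlinarith
  have hmem : (t2, (x2, v2)) ∈ Om := ⟨ht2, hpos.le, hm2.le, hm3.le⟩
  obtain ⟨⟨t, x, v⟩, hp, hmax⟩ := hcomp.exists_isMaxOn ⟨_, hmem⟩ hPc
  have hP2 : 0 < Phi (t2, (x2, v2)) := by
    simp only [hPhi]; positivity
  have hPp : 0 < Phi (t, (x, v)) := hP2.trans_le (hmax hmem)
  obtain ⟨htI, hg1, hg2, hg3⟩ := hp
  simp only at htI hg1 hg2 hg3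
  have hfp : 0 ≤ f t x v := hf0 t ⟨htI.1, htI.2.trans_lt ht1⟩ _ _
  simp only [hPhi] at hPp
  have p0 : 0 < f t x v := hfp.lt_of_ne (fun h => by simp [← h] at hPp)
  have p1 : 0 < sg t x v := hg1.lt_of_ne (fun h => by simp [← h] at hPp)
  have p2 : 0 < s2 t x := hg2.lt_of_ne (fun h => by simp [← h] at hPp)
  have p3 : 0 < s3 t v := hg3.lt_of_ne (fun h => by simp [← h] at hPp)
  have htpos : 0 < t := htI.1.lt_of_ne (fun h => by
    subst h; exact p0.ne' (h0 x v p1))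
  have htI' : t ∈ Set.Ioc 0 t1 := ⟨htpos, htI.2⟩
  have hxA : ‖x‖ ≤ A := by
    have h1 : 0 < A - t - w x := p2
    have := norm_le_w x
    linarith
  set G1 := F1 lam mu t x v with hG1
  set G2 := F2 q lam mu (ldot lam) e t x v with hG2
  obtain ⟨d1, hd1, hD1⟩ := hsg t htI' x v hxA
  have hD0 := f_line hs.2.2.1 hs.2.2.2.2.2.2.2.1 ⟨htpos, htI.2.trans_lt ht1⟩ x v G1 G2
  rw [hG1, hG2, sub_self, sub_self, map_zero, map_zero, add_zero, ← hG1, ← hG2] at hD0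
  have lt : HasDerivAt (fun s : ℝ => t + s) 1 0 := by
    simpa using (hasDerivAt_id (0:ℝ)).const_add t
  have hD2 : HasDerivAt (fun s : ℝ => s2 (t + s) (x + s • G1)) (-1 - (inner ℝ x G1 : ℝ) / w x) 0 :=
    (lt.const_sub A).sub (w_line x G1)
  have hD3 : HasDerivAt (fun s : ℝ => s3 (t + s) (v + s • G2))
      (B * (Real.exp (-(C * (t + 0))) * (-(C * 1))) - (inner ℝ v G2 : ℝ) / w v) 0 :=
    (((lt.const_mul C).neg.exp).const_mul B).sub (w_line v G2)
  have hDe : HasDerivAt (fun s : ℝ => Real.exp (-(t + s))) (Real.exp (-(t + 0)) * (-1)) 0 :=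
    lt.neg.exp
  have hd2 : -1 - (inner ℝ x G1 : ℝ) / w x ≤ 0 := by
    have h1 := w_line_abs x G1
    have h2 := F1_norm_le hs ⟨htI.1, htI.2.trans_lt ht1⟩ x v
    have := (abs_le.1 (h1.trans h2)).1
    linarith
  have hd3 : B * (Real.exp (-(C * (t + 0))) * (-(C * 1))) - (inner ℝ v G2 : ℝ) / w v ≤ 0 := by
    have h1 := w_line_abs v G2
    have h2 := hC t htI' x v hxA
    have h3 := (abs_le.1 (h1.trans h2)).1
    have h4 : 0 < B * Real.exp (-(C * t)) - w v := p3
    have h5 : C * w v ≤ C * (B * Real.exp (-(C * t))) := by gcongr; linarith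
    rw [add_zero]
    linarith
  have hDall := hD0.mul (((hD1.mul hD2).mul hD3).mul hDe)
  have hneg := left_max hDall ?_
  · simp only [Pi.mul_apply, add_zero, zero_smul, zero_mul, zero_add] at hneg
    have hE := Real.exp_pos (-t)
    set X2 := -1 - (inner ℝ x G1 : ℝ) / w x
    simp only [add_zero] at hd3
    set X3 := B * (Real.exp (-(C * t)) * (-(C * 1))) - (inner ℝ v G2 : ℝ) / w v
    have : ((d1 * s2 t x + sg t x v * X2) * s3 t v + sg t x v * s2 t x * X3) ≤ 0 := by
      have a1 : d1 * s2 t x ≤ 0 := mul_nonpos_of_nonpos_of_nonneg hd1 p2.le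
      have a2 : sg t x v * X2 ≤ 0 := mul_nonpos_of_nonneg_of_nonpos p1.le hd2
      have a3 : (d1 * s2 t x + sg t x v * X2) * s3 t v ≤ 0 :=
        mul_nonpos_of_nonpos_of_nonneg (by linarith) p3.le
      have a4 : sg t x v * s2 t x * X3 ≤ 0 :=
        mul_nonpos_of_nonneg_of_nonpos (by positivity) hd3
      linarith
    have b1 : ((d1 * s2 t x + sg t x v * X2) * s3 t v + sg t x v * s2 t x * X3) * Real.exp (-t) ≤ 0 :=
      mul_nonpos_of_nonpos_of_nonneg this hE.le
    have b2 : 0 < sg t x v * s2 t x * s3 t v * Real.exp (-t) := by positivity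
    have b3 : f t x v * (((d1 * s2 t x + sg t x v * X2) * s3 t v + sg t x v * s2 t x * X3)
        * Real.exp (-t) + sg t x v * s2 t x * s3 t v * (Real.exp (-t) * (-1))) < 0 :=
      mul_neg_of_pos_of_neg p0 (by linarith)
    linarith
  · have e1 : ∀ᶠ s in 𝓝 (0:ℝ), 0 < sg (t + s) (x + s • G1) (v + s • G2) :=
      continuousAt_const.eventually_lt hD1.continuousAt (by simpa using p1)
    have e2 : ∀ᶠ s in 𝓝 (0:ℝ), 0 < s2 (t + s) (x + s • G1) :=
      continuousAt_const.eventually_lt hD2.continuousAt (by simpa using p2)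
    have e3 : ∀ᶠ s in 𝓝 (0:ℝ), 0 < s3 (t + s) (v + s • G2) :=
      continuousAt_const.eventually_lt hD3.continuousAt (by simpa using p3)
    have e4 : ∀ᶠ s in 𝓝 (0:ℝ), 0 < t + s :=
      continuousAt_const.eventually_lt lt.continuousAt (by simpa using htpos)
    filter_upwards [nhdsWithin_le_nhds e1, nhdsWithin_le_nhds e2, nhdsWithin_le_nhds e3,
      nhdsWithin_le_nhds e4, self_mem_nhdsWithin] with s k1 k2 k3 k4 k5
    have k5' : s < 0 := k5
    have hin : (t + s, (x + s • G1, v + s • G2)) ∈ Om :=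
      ⟨⟨k4.le, by linarith [htI.2]⟩, k1.le, k2.le, k3.le⟩
    have := hmax hin
    simpa [hPhi] using this

/-- locally uniform compact support -/
lemma unif_supp {q T t1 : ℝ} {lam mu e : ℝ → ℝ → ℝ} {f : ℝ → E3 → E3 → ℝ}
    (hs : RegularSolution q (Set.Ico 0 T) lam mu e f) (h01 : 0 ≤ t1) (ht1 : t1 < T) :
    ∃ P, 0 ≤ P ∧ ∀ t ∈ Set.Icc 0 t1, ∀ x v, (P < ‖x‖ ∨ P < ‖v‖) → f t x v = 0 := by
  obtain ⟨P0, hP0, hsupp⟩ := exists_supp (hs.2.2.1.2.2.2 0 ⟨le_rfl, h01.trans_lt ht1⟩)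
  have wc := w_cont
  have lt : ∀ t : ℝ, HasDerivAt (fun s : ℝ => t + s) 1 0 := fun t => by
    simpa using (hasDerivAt_id (0:ℝ)).const_add t
  have step1 : ∀ t ∈ Set.Icc 0 t1, ∀ x v, 1 + P0 + t < w x → f t x v = 0 := by
    intro t ht x v hx
    obtain ⟨C, hC0, hC⟩ := F2_norm_le hs ht1 (t + w x + 1)
    refine supp_lemma hs ht1 hC0 hC (fun t x v => w x - (1 + P0 + t)) (by fun_prop) ?_ ?_ t ht x v
      (by linarith) (by linarith)
    · intro t ht x v hx
      refine ⟨_, ?_, (w_line x _).sub ((lt t).const_add (1 + P0))⟩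
      have h2 := F1_norm_le hs ⟨ht.1.le, ht.2.trans_lt ht1⟩ x v
      have := (abs_le.1 ((w_line_abs x (F1 lam mu t x v)).trans h2)).2
      linarith
    · intro x v hx
      refine hsupp x v (Or.inl ?_)
      have := w_le x
      linarith
  obtain ⟨C, hC0, hC⟩ := F2_norm_le hs ht1 (1 + P0 + 2 * t1 + 1)
  have step2 : ∀ t ∈ Set.Icc 0 t1, ∀ x v, (1 + P0) < w v * Real.exp (-(C * t)) → f t x v = 0 := by
    intro t ht x v hv
    by_cases hx : 1 + P0 + t < w x
    · exact step1 t ht x v hx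
    refine supp_lemma hs ht1 hC0 hC (fun t x v => w v * Real.exp (-(C * t)) - (1 + P0))
      (by fun_prop) ?_ ?_ t ht x v (by linarith [ht.2, not_lt.1 hx]) (by linarith)
    · intro t ht x v hx
      refine ⟨_, ?_, ((w_line v _).mul (((lt t).const_mul C).neg.exp)).sub_const (1 + P0)⟩
      have h2 := hC t ht x v hx
      have h3 := (abs_le.1 ((w_line_abs v (F2 q lam mu (ldot lam) e t x v)).trans h2)).2
      have hE := Real.exp_pos (-(C * t))
      simp only [add_zero, zero_smul, Pi.neg_apply]
      nlinarith
    · intro x v hx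
      refine hsupp x v (Or.inr ?_)
      have := w_le v
      simp at hx
      linarith
  refine ⟨max (1 + P0 + t1) ((1 + P0) * Real.exp (C * t1)), by positivity, ?_⟩
  intro t ht x v h
  rcases h with h | h
  · apply step1 t ht
    have := (le_max_left _ _).trans_lt h
    linarith [norm_le_w x, ht.2]
  · apply step2 t ht
    have h1 := (le_max_right _ _).trans_lt h
    have h2 := h1.trans_le (norm_le_w v)
    have h3 : Real.exp (C * t) ≤ Real.exp (C * t1) := Real.exp_le_exp.2 (by gcongr; exact ht.2)
    have h4 : (1 + P0) * Real.exp (C * t) < w v := lt_of_le_of_lt (by gcongr) h2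
    calc 1 + P0 = (1 + P0) * Real.exp (C * t) * Real.exp (-(C * t)) := by
          rw [mul_assoc, ← Real.exp_add]; simp
      _ < _ := by gcongr

/-- A regular solution with uniform support radius `R` and uniform bound `K` up to time `t1`. -/
structure BdSol (q T t1 R K : ℝ) (lam mu e : ℝ → ℝ → ℝ) (f : ℝ → E3 → E3 → ℝ) : Prop where
  sol : RegularSolution q (Set.Ico 0 T) lam mu e f
  lt : t1 < T
  Rpos : 0 < R
  K0 : 0 ≤ K
  supp : ∀ t ∈ Set.Icc 0 t1, ∀ x v, (R < ‖x‖ ∨ R < ‖v‖) → f t x v = 0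
  fb : ∀ t ∈ Set.Ioc 0 t1, ∀ x v, |f t x v| ≤ K
  gb : ∀ t ∈ Set.Ioc 0 t1, ∀ x v, ‖x‖ ≤ R → ‖v‖ ≤ R →
    ‖fderiv ℝ (fun y => f t y v) x‖ ≤ K ∧ ‖fderiv ℝ (fun u => f t x u) v‖ ≤ K
  lb : ∀ t ∈ Set.Ioc 0 t1, ∀ r ∈ Set.Icc 0 R, lam t r ≤ K
  mb : ∀ t ∈ Set.Ioc 0 t1, ∀ r ∈ Set.Ioc 0 R, |deriv (mu t) r| ≤ K
  eb : ∀ t ∈ Set.Ioc 0 t1, ∀ r ∈ Set.Icc 0 R, |Real.exp (lam t r) * e t r| ≤ K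

lemma BdSol.mono {q T t1 R K K' : ℝ} {lam mu e : ℝ → ℝ → ℝ} {f : ℝ → E3 → E3 → ℝ}
    (h : BdSol q T t1 R K lam mu e f) (hK : K ≤ K') : BdSol q T t1 R K' lam mu e f where
  sol := h.sol
  lt := h.lt
  Rpos := h.Rpos
  K0 := h.K0.trans hK
  supp := h.supp
  fb t ht x v := (h.fb t ht x v).trans hK
  gb t ht x v hx hv := ⟨(h.gb t ht x v hx hv).1.trans hK, (h.gb t ht x v hx hv).2.trans hK⟩
  lb t ht r hr := (h.lb t ht r hr).trans hK
  mb t ht r hr := (h.mb t ht r hr).trans hK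
  eb t ht r hr := (h.eb t ht r hr).trans hK

lemma exists_BdSol {q T t1 P : ℝ} {lam mu e : ℝ → ℝ → ℝ} {f : ℝ → E3 → E3 → ℝ}
    (hs : RegularSolution q (Set.Ico 0 T) lam mu e f) (ht1 : t1 < T)
    (hP : ∀ t ∈ Set.Icc 0 t1, ∀ x v, (P < ‖x‖ ∨ P < ‖v‖) → f t x v = 0) {R : ℝ} (hR : 0 < R)
    (hPR : P ≤ R) : ∃ K, BdSol q T t1 R K lam mu e f := by
  obtain ⟨C1, hC1, h1⟩ := f_grad_bd hs.2.2.1 ht1 R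
  obtain ⟨C2, hC2, h2⟩ := C2_bd0 hs.1.1.continuousOn ht1 R
  obtain ⟨C3, hC3, h3⟩ := C2_bd hs.1.2.1 ht1 R
  obtain ⟨C4, hC4, h4⟩ := C2_bd0 hs.2.1.1 ht1 R
  have hE : 0 ≤ Real.exp C2 * C4 := by positivity
  have hsupp : ∀ t ∈ Set.Icc 0 t1, ∀ x v, (R < ‖x‖ ∨ R < ‖v‖) → f t x v = 0 :=
    fun t ht x v h => hP t ht x v (h.imp hPR.trans_lt hPR.trans_lt)
  refine ⟨C1 + C2 + C3 + Real.exp C2 * C4, hs, ht1, hR, by positivity, hsupp, ?_, ?_, ?_, ?_, ?_⟩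
  · intro t ht x v
    by_cases hx : ‖x‖ ≤ R ∧ ‖v‖ ≤ R
    · linarith [(h1 t ht x v hx.1 hx.2).1]
    · have : R < ‖x‖ ∨ R < ‖v‖ := by
        by_contra hn
        rw [not_or, not_lt, not_lt] at hn
        exact hx hn
      rw [hsupp t ⟨ht.1.le, ht.2⟩ x v this, abs_zero]; positivity
  · intro t ht x v hx hv
    have := h1 t ht x v hx hv
    exact ⟨by linarith [this.2.1], by linarith [this.2.2]⟩
  · intro t ht r hr
    have := (abs_le.1 (h2 t ⟨ht.1.le, ht.2⟩ r hr)).2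
    linarith
  · intro t ht r hr
    have := (h3 t ht r hr).1
    linarith
  · intro t ht r hr
    have a1 := (abs_le.1 (h2 t ⟨ht.1.le, ht.2⟩ r hr)).2
    have a2 := h4 t ⟨ht.1.le, ht.2⟩ r hr
    rw [abs_mul, abs_of_pos (Real.exp_pos _)]
    calc _ ≤ Real.exp C2 * C4 := by gcongr
      _ ≤ _ := by linarith

lemma prod_diff {x1 x2 y1 y2 c c' X Y s : ℝ} (h1 : |x1 - x2| ≤ c * s) (h2 : |y1| ≤ Y)
    (h3 : |x2| ≤ X) (h4 : |y1 - y2| ≤ c' * s) (hX : 0 ≤ X) (hcs : 0 ≤ c * s) :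
    |x1 * y1 - x2 * y2| ≤ (c * Y + X * c') * s := by
  calc |x1 * y1 - x2 * y2| = |(x1 - x2) * y1 + x2 * (y1 - y2)| := by ring_nf
    _ ≤ |x1 - x2| * |y1| + |x2| * |y1 - y2| := by
      rw [← abs_mul, ← abs_mul]; exact abs_add_le _ _
    _ ≤ (c * s) * Y + X * (c' * s) := by gcongr
    _ = _ := by ring

lemma exp_diff {x y M : ℝ} (hx : x ≤ M) (hy : y ≤ M) :
    |Real.exp x - Real.exp y| ≤ Real.exp M * |x - y| := by
  wlog hxy : y ≤ x generalizing x y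
  · rw [abs_sub_comm, abs_sub_comm x y]; exact this hy hx (le_of_not_ge hxy)
  rw [abs_of_nonneg (sub_nonneg.2 (Real.exp_le_exp.2 hxy)), abs_of_nonneg (sub_nonneg.2 hxy)]
  have h1 : Real.exp x - Real.exp y = Real.exp x * (1 - Real.exp (y - x)) := by
    rw [mul_sub, ← Real.exp_add]; ring_nf
  rw [h1]
  have h2 := Real.add_one_le_exp (y - x)
  calc _ ≤ Real.exp x * (x - y) :=
        mul_le_mul_of_nonneg_left (by linarith) (Real.exp_pos x).le
    _ ≤ _ := mul_le_mul_of_nonneg_right (Real.exp_le_exp.2 hx) (by linarith)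

/-- moment constant -/
def mc (R : ℝ) : ℝ := (1 + R) * vb R

section
variable {q T t1 R K : ℝ} {lamf muf ef : ℝ → ℝ → ℝ} {f : ℝ → E3 → E3 → ℝ}
    {lamg mug eg : ℝ → ℝ → ℝ} {g : ℝ → E3 → E3 → ℝ}

lemma mc_nonneg (hR : 0 < R) : 0 ≤ mc R := mul_nonneg (by linarith) (vb_nonneg R)

lemma abs_coord_le (v : E3) : |v 0| ≤ ‖v‖ := by
  have := PiLp.norm_apply_le v 0
  simpa using this

lemma psi_bounds {v : E3} (hv : ‖v‖ ≤ R) : |w v| ≤ 1 + R ∧ |(v 0) ^ 2 / w v| ≤ 1 + R ∧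
    |v 0| ≤ 1 + R ∧ |(1:ℝ)| ≤ 1 + R := by
  have h0 := norm_nonneg v
  have h1 := w_le v
  have h2 := w_pos v
  have h3 := abs_coord_le v
  have h4 := norm_le_w v
  refine ⟨by rw [abs_of_pos h2]; linarith, ?_, by linarith, by rw [abs_one]; linarith⟩
  rw [abs_of_nonneg (div_nonneg (sq_nonneg _) h2.le), div_le_iff₀ h2, ← sq_abs]
  have : |v 0| ^ 2 ≤ ‖v‖ * w v := by nlinarith [abs_nonneg (v 0)]
  nlinarith

lemma cont_slice_v (hs : RegularSolution q (Set.Ico 0 T) lamf muf ef f) {t : ℝ}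
    (ht : t ∈ Set.Ico 0 T) (x : E3) : Continuous (fun v => f t x v) :=
  (f_cont_slice hs.2.2.1 ht).continuous.comp (Continuous.prodMk_right x)

lemma mom_bd (hf : BdSol q T t1 R K lamf muf ef f) {t : ℝ} (ht : t ∈ Set.Ioc 0 t1)
    {psi : E3 → ℝ} (hW : ∀ v, ‖v‖ ≤ R → |psi v| ≤ 1 + R) (x : E3) :
    |∫ v, psi v * f t x v| ≤ mc R * K := by
  have hR := hf.Rpos
  have := vint_bound (h := fun v => psi v * f t x v) (P := R) (C := (1 + R) * K)
    (fun v hv => by rw [hf.supp t ⟨ht.1.le, ht.2⟩ _ _ (Or.inr hv), mul_zero])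
    (fun v hv => by
      rw [abs_mul]
      exact mul_le_mul (hW v hv) (hf.fb t ht x v) (abs_nonneg _) (by linarith))
  unfold mc; linarith

lemma mom_diff (hf : BdSol q T t1 R K lamf muf ef f) (hg : BdSol q T t1 R K lamg mug eg g)
    {t s : ℝ} (ht : t ∈ Set.Ioc 0 t1)
    {psi : E3 → ℝ} (hpsi : Continuous psi) (hW : ∀ v, ‖v‖ ≤ R → |psi v| ≤ 1 + R) (x : E3)
    (hc : ∀ x v, |f t x v - g t x v| ≤ s) :
    |(∫ v, psi v * f t x v) - ∫ v, psi v * g t x v| ≤ mc R * s := by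
  have hR := hf.Rpos
  have htT : t ∈ Set.Ico 0 T := ⟨ht.1.le, ht.2.trans_lt hf.lt⟩
  have := vint_diff (P := R) (W := 1 + R) (a := s) hpsi (cont_slice_v hf.sol htT x)
    (cont_slice_v hg.sol htT x)
    (fun v hv => hf.supp t ⟨ht.1.le, ht.2⟩ _ _ (Or.inr hv))
    (fun v hv => hg.supp t ⟨ht.1.le, ht.2⟩ _ _ (Or.inr hv)) hW (by linarith) (hc x)
  unfold mc; linarith

lemma psi2_cont : Continuous (fun v : E3 => (v 0) ^ 2 / w v) := by
  have := w_cont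
  exact Continuous.div (by fun_prop) this (fun v => (w_pos v).ne')

lemma Mch_bd (hf : BdSol q T t1 R K lamf muf ef f) {t : ℝ} (ht : t ∈ Set.Ioc 0 t1) (r : ℝ) :
    |Mch f t r| ≤ mc R * K := by
  have := mom_bd hf ht (psi := fun _ => 1) (fun v hv => (psi_bounds hv).2.2.2) (pt r)
  simp only [one_mul] at this
  exact this

lemma Mch_diff (hf : BdSol q T t1 R K lamf muf ef f) (hg : BdSol q T t1 R K lamg mug eg g)
    {t s : ℝ} (ht : t ∈ Set.Ioc 0 t1) (r : ℝ) (hc : ∀ x v, |f t x v - g t x v| ≤ s) :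
    |Mch f t r - Mch g t r| ≤ mc R * s := by
  have := mom_diff hf hg ht (psi := fun _ => 1) continuous_const
    (fun v hv => (psi_bounds hv).2.2.2) (pt r) hc
  simp only [one_mul] at this
  exact this

lemma E_zero (hs : RegularSolution q (Set.Ico 0 T) lamf muf ef f) {t : ℝ}
    (ht : t ∈ Set.Ico 0 T) : ef t 0 = 0 := hs.2.1.2.2.1 t ht

lemma mx_cont (hs : RegularSolution q (Set.Ico 0 T) lamf muf ef f) {t : ℝ}
    (ht : t ∈ Set.Ico 0 T) {r : ℝ} (hr : 0 ≤ r) :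
    IntervalIntegrable (fun s => q * s ^ 2 * (Real.exp (lamf t s) * Mch f t s)) volume 0 r := by
  have hlc : ContinuousOn (lamf t) (Set.Ici 0) := (C2_slice_r hs.1.1 ht).continuousOn
  have hMc : Continuous (Mch f t) := by
    have := vint_cont (psi := fun _ => 1) (f_cont_slice hs.2.2.1 ht) (hs.2.2.1.2.2.2 t ht)
      continuous_const
    simp only [one_mul] at this
    exact this
  apply ContinuousOn.intervalIntegrable
  rw [Set.uIcc_of_le hr]
  refine ContinuousOn.mono ?_ (Set.Icc_subset_Ici_self)
  exact (continuousOn_const.mul (continuousOn_id.pow 2)).mul (hlc.rexp.mul hMc.continuousOn)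

/-- closeness of two solutions at time `t` -/
def Close (R : ℝ) (lamf : ℝ → ℝ → ℝ) (f : ℝ → E3 → E3 → ℝ) (lamg : ℝ → ℝ → ℝ)
    (g : ℝ → E3 → E3 → ℝ) (t s : ℝ) : Prop :=
  0 ≤ s ∧ (∀ x v, |f t x v - g t x v| ≤ s) ∧ (∀ r ∈ Set.Icc 0 R, |lamf t r - lamg t r| ≤ r * s)

lemma expl_diff (hf : BdSol q T t1 R K lamf muf ef f) (hg : BdSol q T t1 R K lamg mug eg g)
    {t s : ℝ} (ht : t ∈ Set.Ioc 0 t1) (hc : Close R lamf f lamg g t s) {r : ℝ}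
    (hr : r ∈ Set.Icc 0 R) :
    |Real.exp (lamf t r) - Real.exp (lamg t r)| ≤ (Real.exp K * R) * s := by
  refine (exp_diff (hf.lb t ht r hr) (hg.lb t ht r hr)).trans ?_
  rw [mul_assoc]
  gcongr
  exact (hc.2.2 r hr).trans (mul_le_mul_of_nonneg_right hr.2 hc.1)

lemma exp2l_diff (hf : BdSol q T t1 R K lamf muf ef f) (hg : BdSol q T t1 R K lamg mug eg g)
    {t s : ℝ} (ht : t ∈ Set.Ioc 0 t1) (hc : Close R lamf f lamg g t s) {r : ℝ}
    (hr : r ∈ Set.Icc 0 R) :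
    |Real.exp (2 * lamf t r) - Real.exp (2 * lamg t r)| ≤ (2 * Real.exp (2 * K) * r) * s := by
  have h1 := hf.lb t ht r hr
  have h2 := hg.lb t ht r hr
  refine (exp_diff (M := 2 * K) (by linarith) (by linarith)).trans ?_
  have h3 := hc.2.2 r hr
  rw [← mul_sub, abs_mul, abs_two]
  calc _ ≤ Real.exp (2 * K) * (2 * (r * s)) := by gcongr
    _ = _ := by ring

lemma est_E (hf : BdSol q T t1 R K lamf muf ef f) (hg : BdSol q T t1 R K lamg mug eg g) :
    ∃ C, 0 ≤ C ∧ ∀ t ∈ Set.Ioc 0 t1, ∀ s, Close R lamf f lamg g t s → ∀ r ∈ Set.Icc 0 R,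
      |Real.exp (lamf t r) * ef t r - Real.exp (lamg t r) * eg t r| ≤ C * s := by
  have hR := hf.Rpos
  have hm := mc_nonneg hR
  have hK := hf.K0
  set C1 := (Real.exp K * R) * (mc R * K) + Real.exp K * mc R with hC1
  have hC1' : 0 ≤ C1 := by positivity
  refine ⟨|q| * C1 * R, by positivity, fun t ht s hc r hr => ?_⟩
  have hs := hc.1
  have htT : t ∈ Set.Ico 0 T := ⟨ht.1.le, ht.2.trans_lt hf.lt⟩
  rcases hr.1.eq_or_lt with h0 | hr0
  · rw [← h0, E_zero hf.sol htT, E_zero hg.sol htT]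
    simp; positivity
  have e1 := maxwell_slice hf.sol htT r hr.1
  have e2 := maxwell_slice hg.sol htT r hr.1
  have e3 : r ^ 2 * (Real.exp (lamf t r) * ef t r - Real.exp (lamg t r) * eg t r) =
      ∫ u in (0:ℝ)..r, (q * u ^ 2 * (Real.exp (lamf t u) * Mch f t u)
        - q * u ^ 2 * (Real.exp (lamg t u) * Mch g t u)) := by
    rw [intervalIntegral.integral_sub (mx_cont hf.sol htT hr.1) (mx_cont hg.sol htT hr.1),
      ← e1, ← e2]; ring
  have e4 : ‖∫ u in (0:ℝ)..r, (q * u ^ 2 * (Real.exp (lamf t u) * Mch f t u)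
        - q * u ^ 2 * (Real.exp (lamg t u) * Mch g t u))‖ ≤ (|q| * r ^ 2 * (C1 * s)) * |r - 0| := by
    apply intervalIntegral.norm_integral_le_of_norm_le_const
    intro u hu
    rw [Set.uIoc_of_le hr.1] at hu
    have hu' : u ∈ Set.Icc 0 R := ⟨hu.1.le, hu.2.trans hr.2⟩
    rw [← mul_sub, norm_mul, norm_mul, norm_pow, Real.norm_eq_abs, Real.norm_eq_abs,
      Real.norm_eq_abs, abs_of_pos hu.1]
    have := prod_diff (expl_diff hf hg ht hc hu') (Mch_bd hf ht u)
      (by rw [abs_of_pos (Real.exp_pos _)]; exact Real.exp_le_exp.2 (hg.lb t ht u hu'))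
      (Mch_diff hf hg ht u hc.2.1) (Real.exp_pos K).le (by positivity)
    have hu1 := hu.1
    have hu2 := hu.2
    gcongr
  rw [← e3, norm_mul, norm_pow, Real.norm_eq_abs, Real.norm_eq_abs, abs_of_pos hr0, sub_zero,
    abs_of_pos hr0] at e4
  have e5 : r ^ 2 * |Real.exp (lamf t r) * ef t r - Real.exp (lamg t r) * eg t r| ≤
      r ^ 2 * (|q| * C1 * r * s) := by linarith
  have e6 := le_of_mul_le_mul_left e5 (by positivity)
  refine e6.trans ?_
  have := hr.2
  gcongr

lemma est_sum (hf : BdSol q T t1 R K lamf muf ef f) (hg : BdSol q T t1 R K lamg mug eg g) :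
    ∃ C, 0 ≤ C ∧ ∀ t ∈ Set.Ioc 0 t1, ∀ s, Close R lamf f lamg g t s → ∀ r ∈ Set.Icc 0 R,
      |(lamf t r + muf t r) - (lamg t r + mug t r)| ≤ C * s := by
  have hR := hf.Rpos
  have hm := mc_nonneg hR
  have hK := hf.K0
  have hpi := Real.pi_pos
  set C1 := (2 * Real.exp (2 * K) * R) * (mc R * K + mc R * K)
    + Real.exp (2 * K) * (mc R + mc R) with hC1
  have hC1' : 0 ≤ C1 := by positivity
  refine ⟨4 * π * R * C1 * R, by positivity, fun t ht s hc r hr => ?_⟩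
  have hs := hc.1
  have htT : t ∈ Set.Ico 0 T := ⟨ht.1.le, ht.2.trans_lt hf.lt⟩
  have htI : t ∈ Set.Icc 0 t1 := ⟨ht.1.le, ht.2⟩
  have z1 := sum_zero hf.sol htT hR.le (fun x v h => hf.supp t htI x v (Or.inl h))
  have z2 := sum_zero hg.sol htT hR.le (fun x v h => hg.supp t htI x v (Or.inl h))
  rcases hr.2.eq_or_lt with h0 | hrR
  · rw [h0, z1, z2, sub_zero, abs_zero]; positivity
  have hcont : ContinuousOn (fun u => (lamf t u + muf t u) - (lamg t u + mug t u))
      (Set.Icc r R) :=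
    ((((C2_slice_r hf.sol.1.1 htT).continuousOn).add (C2_slice_r hf.sol.1.2.1 htT).continuousOn).sub
    (((C2_slice_r hg.sol.1.1 htT).continuousOn).add
      (C2_slice_r hg.sol.1.2.1 htT).continuousOn)).mono (fun u hu => hr.1.trans hu.1)
  obtain ⟨c, hcI, hce⟩ := exists_hasDerivAt_eq_slope
    (fun u => (lamf t u + muf t u) - (lamg t u + mug t u)) _ hrR hcont
    (fun u hu => (sum_deriv hf.sol htT (hr.1.trans_lt hu.1)).sub
      (sum_deriv hg.sol htT (hr.1.trans_lt hu.1)))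
  have hc0 : 0 < c := hr.1.trans_lt hcI.1
  have hcR : c ∈ Set.Icc 0 R := ⟨hc0.le, hcI.2.le⟩
  rw [← mul_sub] at hce
  have b1 : |Real.exp (2 * lamf t c) - Real.exp (2 * lamg t c)| ≤ (2 * Real.exp (2 * K) * R) * s := by
    refine (exp2l_diff hf hg ht hc hcR).trans ?_
    have := hcR.2
    gcongr
  have b2 := prod_diff b1
    ((abs_add_le _ _).trans (add_le_add
      (mom_bd hf ht (psi := w) (fun v hv => (psi_bounds hv).1) (pt c))
      (mom_bd hf ht (psi := fun v => (v 0) ^ 2 / w v) (fun v hv => (psi_bounds hv).2.1) (pt c))))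
    (X := Real.exp (2 * K)) (x2 := Real.exp (2 * lamg t c)) (c' := mc R + mc R)
    (y2 := (∫ v, w v * g t (pt c) v) + ∫ v, (v 0) ^ 2 / w v * g t (pt c) v)
    (by rw [abs_of_pos (Real.exp_pos _)]; exact Real.exp_le_exp.2 (by linarith [hg.lb t ht c hcR]))
    (by
      have a1 := mom_diff hf hg ht w_cont (fun v hv => (psi_bounds hv).1) (pt c) hc.2.1
      have a2 := mom_diff hf hg ht psi2_cont (fun v hv => (psi_bounds hv).2.1) (pt c) hc.2.1
      rw [add_mul, add_sub_add_comm]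
      exact (abs_add_le _ _).trans (add_le_add a1 a2))
    (Real.exp_pos _).le (by positivity)
  have hRr : 0 < R - r := by linarith
  simp only [z1, z2, sub_self, zero_sub] at hce
  rw [eq_div_iff hRr.ne'] at hce
  rw [← abs_neg, ← hce, abs_mul, abs_mul, abs_of_pos hRr, abs_of_pos (by positivity : 0 < 4 * π * c)]
  have h1 := hcI.2.le
  have h2 : R - r ≤ R := by linarith [hr.1]
  calc _ ≤ 4 * π * R * (C1 * s) * R := by gcongr
    _ = _ := by ring

lemma est_mu (hf : BdSol q T t1 R K lamf muf ef f) (hg : BdSol q T t1 R K lamg mug eg g) :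
    ∃ C, 0 ≤ C ∧ ∀ t ∈ Set.Ioc 0 t1, ∀ s, Close R lamf f lamg g t s → ∀ r ∈ Set.Icc 0 R,
      |muf t r - mug t r| ≤ C * s := by
  obtain ⟨C, hC0, hC⟩ := est_sum hf hg
  refine ⟨C + R, by have := hf.Rpos; linarith, fun t ht s hc r hr => ?_⟩
  have h1 := hC t ht s hc r hr
  have h2 : |lamf t r - lamg t r| ≤ R * s :=
    (hc.2.2 r hr).trans (mul_le_mul_of_nonneg_right hr.2 hc.1)
  rw [abs_le] at *
  constructor <;> linarith

lemma mu_prime (hs : RegularSolution q (Set.Ico 0 T) lamf muf ef f) {t : ℝ}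
    (ht : t ∈ Set.Ico 0 T) {r : ℝ} (hr : 0 ≤ r) :
    2 * r * deriv (muf t) r = Real.exp (2 * lamf t r) - 1
      + 8 * π * r ^ 2 * (Real.exp (2 * lamf t r) * prs lamf ef f t r) := by
  have h28 := hs.2.2.2.2.2.1 t ht r hr
  have e3 : Real.exp (2 * lamf t r) * Real.exp (-2 * lamf t r) = 1 := by
    rw [← Real.exp_add]; simp
  calc _ = Real.exp (2 * lamf t r) * Real.exp (-2 * lamf t r) * (2 * r * deriv (muf t) r + 1) - 1 := by
        rw [e3]; ring
    _ = Real.exp (2 * lamf t r) *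
        ((Real.exp (-2 * lamf t r) * (2 * r * deriv (muf t) r + 1) - 1) + 1) - 1 := by ring
    _ = _ := by rw [h28]; ring

lemma est_mu' (hf : BdSol q T t1 R K lamf muf ef f) (hg : BdSol q T t1 R K lamg mug eg g) :
    ∃ C, 0 ≤ C ∧ ∀ t ∈ Set.Ioc 0 t1, ∀ s, Close R lamf f lamg g t s → ∀ r ∈ Set.Ioc 0 R,
      |deriv (muf t) r - deriv (mug t) r| ≤ C * s := by
  obtain ⟨CE, hCE0, hCE⟩ := est_E hf hg
  have hR := hf.Rpos
  have hm := mc_nonneg hR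
  have hK := hf.K0
  have hpi := Real.pi_pos
  set Cp := mc R + K * CE with hCp
  have hCp0 : 0 ≤ Cp := by positivity
  set C1 := (2 * Real.exp (2 * K) * R) * (mc R * K + 1 / 2 * K ^ 2) + Real.exp (2 * K) * Cp with hC1
  have hC10 : 0 ≤ C1 := by positivity
  refine ⟨Real.exp (2 * K) + 4 * π * R * C1, by positivity, fun t ht s hc r hr => ?_⟩
  have hs := hc.1
  have htT : t ∈ Set.Ico 0 T := ⟨ht.1.le, ht.2.trans_lt hf.lt⟩
  have hr' : r ∈ Set.Icc 0 R := ⟨hr.1.le, hr.2⟩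
  have hr0 := hr.1
  have e1 := mu_prime hf.sol htT hr.1.le
  have e2 := mu_prime hg.sol htT hr.1.le
  have dl := exp2l_diff hf hg ht hc hr'
  have dl' : |Real.exp (2 * lamf t r) - Real.exp (2 * lamg t r)| ≤ (2 * Real.exp (2 * K) * R) * s :=
    dl.trans (by have := hr.2; gcongr)
  have pb : |prs lamf ef f t r| ≤ mc R * K + 1 / 2 * K ^ 2 := by
    rw [prs_eq]
    refine (abs_sub _ _).trans (add_le_add (mom_bd hf ht (fun v hv => (psi_bounds hv).2.1) _) ?_)
    rw [abs_mul, abs_pow, abs_of_pos (by norm_num : (0:ℝ) < 1 / 2)]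
    have := hf.eb t ht r hr'
    gcongr
  have pd : |prs lamf ef f t r - prs lamg eg g t r| ≤ Cp * s := by
    rw [prs_eq, prs_eq]
    have a1 := mom_diff hf hg ht psi2_cont (fun v hv => (psi_bounds hv).2.1) (pt r) hc.2.1
    have a2 := hCE t ht s hc r hr'
    have a3 := hf.eb t ht r hr'
    have a4 := hg.eb t ht r hr'
    set E1 := Real.exp (lamf t r) * ef t r
    set E2 := Real.exp (lamg t r) * eg t r
    have a5 : |1 / 2 * E1 ^ 2 - 1 / 2 * E2 ^ 2| ≤ K * (CE * s) := by
      have : 1 / 2 * E1 ^ 2 - 1 / 2 * E2 ^ 2 = ((E1 + E2) / 2) * (E1 - E2) := by ring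
      rw [this, abs_mul]
      gcongr
      rw [abs_le] at *
      constructor <;> linarith
    rw [sub_sub_sub_comm]
    refine (abs_sub _ _).trans ((add_le_add a1 a5).trans (le_of_eq ?_))
    rw [hCp]; ring
  have b2 := prod_diff dl' pb (X := Real.exp (2 * K))
    (by rw [abs_of_pos (Real.exp_pos _)]; exact Real.exp_le_exp.2 (by linarith [hg.lb t ht r hr']))
    pd (Real.exp_pos _).le (by positivity)
  have e3 : 2 * r * |deriv (muf t) r - deriv (mug t) r| ≤
      2 * r * ((Real.exp (2 * K) + 4 * π * R * C1) * s) := by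
    calc 2 * r * |deriv (muf t) r - deriv (mug t) r|
        = |2 * r * deriv (muf t) r - 2 * r * deriv (mug t) r| := by
          rw [← mul_sub, abs_mul, abs_of_pos (by positivity : 0 < 2 * r)]
      _ = |(Real.exp (2 * lamf t r) - Real.exp (2 * lamg t r)) + 8 * π * r ^ 2 *
          (Real.exp (2 * lamf t r) * prs lamf ef f t r
            - Real.exp (2 * lamg t r) * prs lamg eg g t r)| := by
          rw [e1, e2]; ring_nf
      _ ≤ (2 * Real.exp (2 * K) * r) * s + 8 * π * r ^ 2 * (C1 * s) := by
          refine (abs_add_le _ _).trans (add_le_add dl ?_)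
          rw [abs_mul, abs_of_pos (by positivity : 0 < 8 * π * r ^ 2)]
          gcongr
      _ = 2 * r * ((Real.exp (2 * K) + 4 * π * r * C1) * s) := by ring
      _ ≤ _ := by have := hr.2; gcongr
  exact le_of_mul_le_mul_left e3 (by positivity)

lemma est_ldot (hf : BdSol q T t1 R K lamf muf ef f) (hg : BdSol q T t1 R K lamg mug eg g) :
    ∃ C, 0 ≤ C ∧ ∀ t ∈ Set.Ioc 0 t1, ∀ s, Close R lamf f lamg g t s → ∀ r ∈ Set.Icc 0 R,
      |ldot lamf t r - ldot lamg t r| ≤ r * (C * s) := by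
  obtain ⟨CS, hCS0, hCS⟩ := est_sum hf hg
  have hR := hf.Rpos
  have hm := mc_nonneg hR
  have hK := hf.K0
  have hpi := Real.pi_pos
  set C1 := CS * (mc R * K) + 1 * mc R with hC1
  have hC10 : 0 ≤ C1 := by positivity
  refine ⟨4 * π * C1, by positivity, fun t ht s hc r hr => ?_⟩
  have hs := hc.1
  have htT : t ∈ Set.Ico 0 T := ⟨ht.1.le, ht.2.trans_lt hf.lt⟩
  have e1 : ldot lamf t r = _ := hf.sol.2.2.2.2.1 t htT r hr.1
  have e2 : ldot lamg t r = _ := hg.sol.2.2.2.2.1 t htT r hr.1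
  have n1 := sum_nonpos hf.sol htT hr.1
  have n2 := sum_nonpos hg.sol htT hr.1
  have d1 : |Real.exp (lamf t r + muf t r) - Real.exp (lamg t r + mug t r)| ≤ CS * s := by
    refine (exp_diff n1 n2).trans ?_
    rw [Real.exp_zero, one_mul]
    exact hCS t ht s hc r hr
  have k1 : |kk f t r| ≤ mc R * K :=
    mom_bd hf ht (psi := fun v => v 0) (fun v hv => (psi_bounds hv).2.2.1) (pt r)
  have k2 : |kk f t r - kk g t r| ≤ mc R * s :=
    mom_diff hf hg ht (psi := fun v => v 0) (by fun_prop)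
      (fun v hv => (psi_bounds hv).2.2.1) (pt r) hc.2.1
  have b := prod_diff d1 k1 (X := 1)
    (by rw [abs_of_pos (Real.exp_pos _)]; exact Real.exp_le_one_iff.2 n2) k2 zero_le_one
    (by positivity)
  rw [e1, e2]
  have : -(4 * π) * r * Real.exp (lamf t r + muf t r) * kk f t r
      - -(4 * π) * r * Real.exp (lamg t r + mug t r) * kk g t r
      = -(4 * π * r * (Real.exp (lamf t r + muf t r) * kk f t r
        - Real.exp (lamg t r + mug t r) * kk g t r)) := by ring
  rw [this, abs_neg, abs_mul, abs_of_nonneg (by have := hr.1; positivity : 0 ≤ 4 * π * r)]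
  have := hr.1
  calc _ ≤ 4 * π * r * (C1 * s) := by gcongr
    _ = _ := by ring

lemma ldot_bd (hf : BdSol q T t1 R K lamf muf ef f) :
    ∀ t ∈ Set.Ioc 0 t1, ∀ r ∈ Set.Icc 0 R, |ldot lamf t r| ≤ r * (4 * π * (mc R * K)) := by
  intro t ht r hr
  have hR := hf.Rpos
  have hm := mc_nonneg hR
  have hK := hf.K0
  have hpi := Real.pi_pos
  have htT : t ∈ Set.Ico 0 T := ⟨ht.1.le, ht.2.trans_lt hf.lt⟩
  have e1 : ldot lamf t r = _ := hf.sol.2.2.2.2.1 t htT r hr.1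
  have n1 := sum_nonpos hf.sol htT hr.1
  have k1 : |kk f t r| ≤ mc R * K :=
    mom_bd hf ht (psi := fun v => v 0) (fun v hv => (psi_bounds hv).2.2.1) (pt r)
  have h1 := Real.exp_le_one_iff.2 n1
  have hr0 := hr.1
  rw [e1, abs_mul, abs_mul, abs_mul, abs_neg, abs_of_pos (Real.exp_pos _),
    abs_of_pos (by positivity : 0 < 4 * π), abs_of_nonneg hr0]
  calc _ ≤ 4 * π * r * 1 * (mc R * K) := by gcongr
    _ = _ := by ring

end

section
variable {q T t1 R K : ℝ} {lamf muf ef : ℝ → ℝ → ℝ} {f : ℝ → E3 → E3 → ℝ}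
    {lamg mug eg : ℝ → ℝ → ℝ} {g : ℝ → E3 → E3 → ℝ}

lemma est_exp (hf : BdSol q T t1 R K lamf muf ef f) (hg : BdSol q T t1 R K lamg mug eg g) :
    ∃ C, 0 ≤ C ∧ ∀ t ∈ Set.Ioc 0 t1, ∀ s, Close R lamf f lamg g t s → ∀ r ∈ Set.Icc 0 R,
      |Real.exp (muf t r - lamf t r) - Real.exp (mug t r - lamg t r)| ≤ C * s ∧
      |Real.exp (muf t r) - Real.exp (mug t r)| ≤ C * s := by
  obtain ⟨C, hC0, hC⟩ := est_mu hf hg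
  have hR := hf.Rpos
  refine ⟨C + R, by positivity, fun t ht s hc r hr => ?_⟩
  have htT : t ∈ Set.Ico 0 T := ⟨ht.1.le, ht.2.trans_lt hf.lt⟩
  have a1 := lam_nonneg hf.sol htT hr.1
  have a2 := sum_nonpos hf.sol htT hr.1
  have a3 := lam_nonneg hg.sol htT hr.1
  have a4 := sum_nonpos hg.sol htT hr.1
  have h1 := hC t ht s hc r hr
  have h2 : |lamf t r - lamg t r| ≤ R * s :=
    (hc.2.2 r hr).trans (mul_le_mul_of_nonneg_right hr.2 hc.1)
  have hs := hc.1
  have hRs : 0 ≤ R * s := by positivity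
  constructor
  · refine (exp_diff (M := 0) (by linarith) (by linarith)).trans ?_
    rw [Real.exp_zero, one_mul]
    rw [abs_le] at *
    constructor <;> linarith
  · refine (exp_diff (M := 0) (by linarith) (by linarith)).trans ?_
    rw [Real.exp_zero, one_mul]
    linarith

lemma est_F (hf : BdSol q T t1 R K lamf muf ef f) (hg : BdSol q T t1 R K lamg mug eg g) :
    ∃ C, 0 ≤ C ∧ ∀ t ∈ Set.Ioc 0 t1, ∀ s, Close R lamf f lamg g t s → ∀ x v,
      ‖x‖ ≤ R → ‖v‖ ≤ R → ‖F1 lamf muf t x v - F1 lamg mug t x v‖ ≤ C * s ∧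
      ‖F2 q lamf muf (ldot lamf) ef t x v - F2 q lamg mug (ldot lamg) eg t x v‖ ≤ C * s := by
  obtain ⟨C1, hC10, hC1⟩ := est_exp hf hg
  obtain ⟨C2, hC20, hC2⟩ := est_mu' hf hg
  obtain ⟨C3, hC30, hC3⟩ := est_ldot hf hg
  obtain ⟨C4, hC40, hC4⟩ := est_E hf hg
  have hR := hf.Rpos
  have hK := hf.K0
  set D := R * C3 * R + (C1 * K + 1 * C2) * (1 + R) + |q| * (C1 * K + 1 * C4) with hD
  have hD0 : 0 ≤ D := by positivity
  refine ⟨C1 + D, by positivity, fun t ht s hc x v hx hv => ?_⟩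
  have hs := hc.1
  have htT : t ∈ Set.Ico 0 T := ⟨ht.1.le, ht.2.trans_lt hf.lt⟩
  have hr : ‖x‖ ∈ Set.Icc 0 R := ⟨norm_nonneg x, hx⟩
  obtain ⟨e1, e2⟩ := hC1 t ht s hc _ hr
  have hwp := w_pos v
  constructor
  · unfold F1
    rw [← sub_smul, ← sub_div, norm_smul, Real.norm_eq_abs, abs_div, abs_of_pos hwp]
    have h1 : ‖v‖ / w v ≤ 1 := (div_le_one hwp).2 (norm_le_w v)
    calc _ = |Real.exp (muf t ‖x‖ - lamf t ‖x‖) - Real.exp (mug t ‖x‖ - lamg t ‖x‖)| * (‖v‖ / w v) := by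
          ring
      _ ≤ (C1 * s) * 1 := by gcongr
      _ ≤ _ := by nlinarith [mul_nonneg hD0 hs]
  by_cases hx0 : x = 0
  · simp only [F2, hx0, if_true, sub_self, norm_zero]; positivity
  have hxp : 0 < ‖x‖ := norm_pos_iff.2 hx0
  have hr' : ‖x‖ ∈ Set.Ioc 0 R := ⟨hxp, hx⟩
  simp only [F2, hx0, if_false]
  rw [← sub_smul, ← sub_div, norm_radial hx0]
  have a3 := lam_nonneg hg.sol htT hr.1
  have a4 := sum_nonpos hg.sol htT hr.1
  have x1 : |Real.exp (mug t ‖x‖ - lamg t ‖x‖)| ≤ 1 := by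
    rw [abs_of_pos (Real.exp_pos _)]; exact Real.exp_le_one_iff.2 (by linarith)
  have x2 : |Real.exp (mug t ‖x‖)| ≤ 1 := by
    rw [abs_of_pos (Real.exp_pos _)]; exact Real.exp_le_one_iff.2 (by linarith)
  have p1 := prod_diff e1 (hf.mb t ht _ hr') x1 (hC2 t ht s hc _ hr') zero_le_one (by positivity)
  have p2 := prod_diff e2 (hf.eb t ht _ hr) x2 (hC4 t ht s hc _ hr) zero_le_one (by positivity)
  have p3 := hC3 t ht s hc _ hr
  have pi := inner_div_le x v
  have q1 : |(Real.exp (muf t ‖x‖ - lamf t ‖x‖) * deriv (muf t) ‖x‖ -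
      Real.exp (mug t ‖x‖ - lamg t ‖x‖) * deriv (mug t) ‖x‖) * w v| ≤
      (C1 * K + 1 * C2) * s * (1 + R) := by
    rw [abs_mul, abs_of_pos hwp]
    have := w_le v
    exact mul_le_mul p1 (by linarith) hwp.le (by positivity)
  have q2 : |q * (Real.exp (muf t ‖x‖) * (Real.exp (lamf t ‖x‖) * ef t ‖x‖) -
      Real.exp (mug t ‖x‖) * (Real.exp (lamg t ‖x‖) * eg t ‖x‖))| ≤
      |q| * ((C1 * K + 1 * C4) * s) := by
    rw [abs_mul]; gcongr
  have q3 : |(ldot lamf t ‖x‖ - ldot lamg t ‖x‖) * ((inner ℝ x v : ℝ) / ‖x‖)| ≤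
      R * (C3 * s) * R := by
    rw [abs_mul]
    refine mul_le_mul (p3.trans ?_) (pi.trans hv) (abs_nonneg _) (by positivity)
    gcongr
  rw [Real.exp_add, Real.exp_add]
  have hfin : D * s ≤ (C1 + D) * s := by nlinarith
  have : D * s = R * (C3 * s) * R + (C1 * K + 1 * C2) * s * (1 + R) + |q| * ((C1 * K + 1 * C4) * s) := by
    rw [hD]; ring
  refine le_trans ?_ hfin
  rw [this, abs_le]
  rw [abs_le] at q1 q2 q3
  constructor <;> linarith [q1.1, q1.2, q2.1, q2.2, q3.1, q3.2]

lemma half_f (hf : BdSol q T t1 R K lamf muf ef f) (hg : BdSol q T t1 R K lamg mug eg g)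
    {C κ S : ℝ} (hC : 0 ≤ C) (hκ : 0 < κ) (hS : 0 ≤ S)
    (hF : ∀ t ∈ Set.Ioc 0 t1, ∀ x v, ‖x‖ ≤ R → ‖v‖ ≤ R →
      ‖F1 lamf muf t x v - F1 lamg mug t x v‖ ≤ C * (S * Real.exp (κ * t)) ∧
      ‖F2 q lamf muf (ldot lamf) ef t x v - F2 q lamg mug (ldot lamg) eg t x v‖
        ≤ C * (S * Real.exp (κ * t)))
    (h0 : ∀ x v, f 0 x v = g 0 x v) :
    ∀ t ∈ Set.Icc 0 t1, ∀ x v, f t x v - g t x v ≤ (2 * K * C * S / κ) * Real.exp (κ * t) := by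
  intro t2 ht2 x2 v2
  have hK := hf.K0
  by_cases hout : R < ‖x2‖ ∨ R < ‖v2‖
  · rw [hf.supp t2 ht2 _ _ hout, hg.supp t2 ht2 _ _ hout, sub_zero]; positivity
  push Not at hout
  set Om : Set (ℝ × (E3 × E3)) :=
    Set.Icc 0 t1 ×ˢ (Metric.closedBall (0:E3) R ×ˢ Metric.closedBall (0:E3) R) with hOm
  have hcomp : IsCompact Om :=
    (isCompact_Icc (a := (0:ℝ)) (b := t1)).prod
      ((isCompact_closedBall (0:E3) R).prod (isCompact_closedBall (0:E3) R))
  set Phi : ℝ × (E3 × E3) → ℝ := fun p => Real.exp (-(κ * p.1)) *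
    (f p.1 p.2.1 p.2.2 - g p.1 p.2.1 p.2.2) with hPhi
  have hPc : ContinuousOn Phi Om := by
    refine ContinuousOn.mul (by fun_prop) ?_
    have hsub : Om ⊆ Set.Ico 0 T ×ˢ Set.univ :=
      fun p hp => ⟨⟨hp.1.1, hp.1.2.trans_lt hf.lt⟩, trivial⟩
    exact (hf.sol.2.2.1.1.continuousOn.mono hsub).sub (hg.sol.2.2.1.1.continuousOn.mono hsub)
  have hmem : (t2, (x2, v2)) ∈ Om := ⟨ht2, by simpa using hout.1, by simpa using hout.2⟩
  obtain ⟨⟨t, x, v⟩, hp, hmax⟩ := hcomp.exists_isMaxOn ⟨_, hmem⟩ hPc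
  have hm2 : Phi (t2, (x2, v2)) ≤ Phi (t, (x, v)) := hmax hmem
  have conv : ∀ {A : ℝ}, Phi (t2, (x2, v2)) ≤ A → f t2 x2 v2 - g t2 x2 v2 ≤ A * Real.exp (κ * t2) := by
    intro A hA
    have e1 : Real.exp (-(κ * t2)) * Real.exp (κ * t2) = 1 := by rw [← Real.exp_add]; simp
    calc _ = (Real.exp (-(κ * t2)) * Real.exp (κ * t2)) * (f t2 x2 v2 - g t2 x2 v2) := by
          rw [e1, one_mul]
      _ = Phi (t2, (x2, v2)) * Real.exp (κ * t2) := by simp only [hPhi]; ring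
      _ ≤ _ := by gcongr
  apply conv
  refine hm2.trans ?_
  by_contra! hlt
  have hPpos : 0 < Phi (t, (x, v)) := lt_of_le_of_lt (by positivity) hlt
  obtain ⟨htI, hx, hv⟩ := hp
  have hx : ‖x‖ ≤ R := by simpa using hx
  have hv : ‖v‖ ≤ R := by simpa using hv
  simp only at htI
  have htpos : 0 < t := htI.1.lt_of_ne (fun h => by
    subst h; simp [hPhi, h0] at hPpos)
  have htI' : t ∈ Set.Ioc 0 t1 := ⟨htpos, htI.2⟩
  have htT : t ∈ Set.Ioo 0 T := ⟨htpos, htI.2.trans_lt hf.lt⟩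
  set G1 := F1 lamf muf t x v with hG1
  set G2 := F2 q lamf muf (ldot lamf) ef t x v with hG2
  have hDf := f_line hf.sol.2.2.1 hf.sol.2.2.2.2.2.2.2.1 htT x v G1 G2
  rw [hG1, hG2, sub_self, sub_self, map_zero, map_zero, add_zero, ← hG1, ← hG2] at hDf
  have hDg := f_line hg.sol.2.2.1 hg.sol.2.2.2.2.2.2.2.1 htT x v G1 G2
  have lt : HasDerivAt (fun s : ℝ => t + s) 1 0 := by
    simpa using (hasDerivAt_id (0:ℝ)).const_add t
  have hDe : HasDerivAt (fun s : ℝ => Real.exp (-(κ * (t + s))))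
      (Real.exp (-(κ * (t + 0))) * (-(κ * 1))) 0 := (lt.const_mul κ).neg.exp
  obtain ⟨hF1, hF2⟩ := hF t htI' x v hx hv
  obtain ⟨g1, g2⟩ := hg.gb t htI' x v hx hv
  have hCS : 0 ≤ C * (S * Real.exp (κ * t)) := by positivity
  have b1 := (ContinuousLinearMap.le_opNorm (fderiv ℝ (fun y => g t y v) x)
    (G1 - F1 lamg mug t x v)).trans (mul_le_mul g1 hF1 (norm_nonneg _) hK)
  have b2 := (ContinuousLinearMap.le_opNorm (fderiv ℝ (fun u => g t x u) v)
    (G2 - F2 q lamg mug (ldot lamg) eg t x v)).trans (mul_le_mul g2 hF2 (norm_nonneg _) hK)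
  rw [Real.norm_eq_abs, abs_le] at b1 b2
  have hD := hDe.mul (hDf.sub hDg)
  have hneg := left_max hD ?_
  · simp only [Pi.sub_apply, add_zero, zero_smul, mul_one, zero_sub] at hneg
    set X1 := (fderiv ℝ (fun y => g t y v) x) (G1 - F1 lamg mug t x v)
    have b2' := b2.1
    set X2 := (fderiv ℝ (fun u => g t x u) v) (G2 - F2 q lamg mug (ldot lamg) eg t x v) with hX2
    have hE := Real.exp_pos (-(κ * t))
    have e1 : Real.exp (-(κ * t)) * Real.exp (κ * t) = 1 := by rw [← Real.exp_add]; simp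
    have k1 : Real.exp (-(κ * t)) * (-(X1 + X2)) ≤ 2 * K * C * S := by
      calc _ ≤ Real.exp (-(κ * t)) * (2 * (K * (C * (S * Real.exp (κ * t))))) := by
            apply mul_le_mul_of_nonneg_left _ hE.le
            linarith [b1.1]
        _ = (Real.exp (-(κ * t)) * Real.exp (κ * t)) * (2 * K * C * S) := by ring
        _ = _ := by rw [e1, one_mul]
    simp only [hPhi] at hlt
    rw [div_lt_iff₀ hκ] at hlt
    have : Real.exp (-(κ * t)) * -κ * (f t x v - g t x v)
        = -(Real.exp (-(κ * t)) * (f t x v - g t x v) * κ) := by ring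
    have hneg' : 0 ≤ Real.exp (-(κ * t)) * -κ * (f t x v - g t x v)
      + Real.exp (-(κ * t)) * (-(X1 + X2)) := hneg
    linarith
  · have e4 : ∀ᶠ s in 𝓝 (0:ℝ), 0 < t + s :=
      continuousAt_const.eventually_lt lt.continuousAt (by simpa using htpos)
    filter_upwards [nhdsWithin_le_nhds e4, self_mem_nhdsWithin] with s k4 k5
    have k5' : s < 0 := k5
    have hti : t + s ∈ Set.Icc 0 t1 := ⟨k4.le, by linarith [htI.2]⟩
    have key : Phi (t + s, (x + s • G1, v + s • G2)) ≤ Phi (t, (x, v)) := by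
      by_cases hout' : R < ‖x + s • G1‖ ∨ R < ‖v + s • G2‖
      · have : Phi (t + s, (x + s • G1, v + s • G2)) = 0 := by
          simp only [hPhi]
          rw [hf.supp _ hti _ _ hout', hg.supp _ hti _ _ hout']; ring
        rw [this]; exact hPpos.le
      · push Not at hout'
        exact hmax ⟨hti, by simpa using hout'.1, by simpa using hout'.2⟩
    simpa [hPhi] using key

lemma half_lam (hf : RegularSolution q (Set.Ico 0 T) lamf muf ef f)
    (hg : RegularSolution q (Set.Ico 0 T) lamg mug eg g) (ht1 : t1 < T)
    {κ c r : ℝ} (hκ : 0 < κ) (hc : 0 ≤ c) (hr : 0 ≤ r)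
    (hd : ∀ t ∈ Set.Ioc 0 t1, ldot lamf t r - ldot lamg t r ≤ c * Real.exp (κ * t))
    (h0 : lamf 0 r = lamg 0 r) :
    ∀ t ∈ Set.Icc 0 t1, lamf t r - lamg t r ≤ c / κ * Real.exp (κ * t) := by
  intro t ht
  have ha : AntitoneOn (fun t => lamf t r - lamg t r - c / κ * Real.exp (κ * t)) (Set.Icc 0 t1) := by
    have hsub : Set.Icc 0 t1 ⊆ Set.Ico 0 T := fun t ht => ⟨ht.1, ht.2.trans_lt ht1⟩
    have hder : ∀ t ∈ Set.Ioo 0 t1, HasDerivAt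
        (fun t => lamf t r - lamg t r - c / κ * Real.exp (κ * t))
        (ldot lamf t r - ldot lamg t r - c / κ * (Real.exp (κ * t) * (κ * 1))) t := by
      intro t ht
      have htT : t ∈ Set.Ioo 0 T := ⟨ht.1, ht.2.trans ht1⟩
      exact ((C2_diff_t hf.1.1 htT hr).hasDerivAt.sub (C2_diff_t hg.1.1 htT hr).hasDerivAt).sub
        ((((hasDerivAt_id t).const_mul κ).exp).const_mul (c / κ))
    apply antitoneOn_of_deriv_nonpos (convex_Icc 0 t1)
    · exact (((C2_slice_t hf.1.1 hr).continuousOn.mono hsub).sub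
        ((C2_slice_t hg.1.1 hr).continuousOn.mono hsub)).sub (by fun_prop)
    · rw [interior_Icc]
      exact fun t ht => (hder t ht).differentiableAt.differentiableWithinAt
    · rw [interior_Icc]
      intro t ht
      rw [(hder t ht).deriv]
      have h1 := hd t ⟨ht.1, ht.2.le⟩
      have : c / κ * (Real.exp (κ * t) * (κ * 1)) = c * Real.exp (κ * t) := by
        field_simp
      linarith
  have := ha ⟨le_rfl, ht.1.trans ht.2⟩ ht ht.1
  simp only [h0, sub_self, mul_zero, Real.exp_zero] at this
  have : 0 ≤ c / κ := by positivity
  linarith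

lemma Close.symm {t s : ℝ} (h : Close R lamf f lamg g t s) : Close R lamg g lamf f t s :=
  ⟨h.1, fun x v => by rw [abs_sub_comm]; exact h.2.1 x v,
    fun r hr => by rw [abs_sub_comm]; exact h.2.2 r hr⟩

lemma all_close (hf : BdSol q T t1 R K lamf muf ef f) (hg : BdSol q T t1 R K lamg mug eg g)
    (h0 : ∀ x v, f 0 x v = g 0 x v) (hl0 : ∀ r, 0 ≤ r → lamf 0 r = lamg 0 r) :
    ∀ t ∈ Set.Ioc 0 t1, Close R lamf f lamg g t 0 := by
  have hK := hf.K0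
  have hR := hf.Rpos
  have hm := mc_nonneg hR
  have hpi := Real.pi_pos
  obtain ⟨C1, hC10, hC1⟩ := est_F hf hg
  obtain ⟨C2, hC20, hC2⟩ := est_ldot hf hg
  set κ := 4 * K * C1 + 2 * C2 + 1 with hκd
  have hκ : 0 < κ := by positivity
  have hk1 : 2 * K * C1 / κ ≤ 1 / 2 := by rw [div_le_iff₀ hκ]; linarith [mul_nonneg hK hC10]
  have hk2 : C2 / κ ≤ 1 / 2 := by rw [div_le_iff₀ hκ]; linarith [mul_nonneg hK hC10]
  -- initial bound
  set D := 2 * (4 * π * (mc R * K)) with hD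
  have hD0 : 0 ≤ D := by positivity
  set S0 := 2 * K + D / κ with hS0
  have hS00 : 0 ≤ S0 := by positivity
  have key : ∀ n : ℕ, ∀ t ∈ Set.Ioc 0 t1,
      Close R lamf f lamg g t (S0 / 2 ^ n * Real.exp (κ * t)) := by
    intro n
    induction n with
    | zero =>
      intro t ht
      have hE : 1 ≤ Real.exp (κ * t) := Real.one_le_exp (mul_nonneg hκ.le ht.1.le)
      simp only [pow_zero, div_one]
      have hDk : 0 ≤ D / κ := by positivity
      refine ⟨by positivity, fun x v => ?_, fun r hr => ?_⟩
      · have a1 := hf.fb t ht x v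
        have a2 := hg.fb t ht x v
        have : S0 * 1 ≤ S0 * Real.exp (κ * t) := by gcongr
        refine (abs_sub _ _).trans ?_
        linarith
      · have hr0 := hr.1
        have b1 := fun t ht => ldot_bd hf t ht r hr
        have b2 := fun t ht => ldot_bd hg t ht r hr
        have hrD : 0 ≤ r * D := by positivity
        have bb : ∀ t ∈ Set.Ioc 0 t1, r * D ≤ (r * D) * Real.exp (κ * t) := by
          intro t ht
          have hE : 1 ≤ Real.exp (κ * t) := Real.one_le_exp (mul_nonneg hκ.le ht.1.le)
          nlinarith
        have u1 := half_lam hf.sol hg.sol hf.lt hκ hrD hr0 (fun t ht => by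
          have k1 := abs_le.1 (b1 t ht)
          have k2 := abs_le.1 (b2 t ht)
          have := bb t ht
          refine le_trans ?_ this
          rw [hD]; linarith [k1.1, k1.2, k2.1, k2.2]) (hl0 r hr0) t ⟨ht.1.le, ht.2⟩
        have u2 := half_lam hg.sol hf.sol hf.lt hκ hrD hr0 (fun t ht => by
          have k1 := abs_le.1 (b1 t ht)
          have k2 := abs_le.1 (b2 t ht)
          have := bb t ht
          refine le_trans ?_ this
          rw [hD]; linarith [k1.1, k1.2, k2.1, k2.2]) (hl0 r hr0).symm t ⟨ht.1.le, ht.2⟩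
        have u3 : r * D / κ * Real.exp (κ * t) ≤ r * (S0 * Real.exp (κ * t)) := by
          have : r * D / κ * Real.exp (κ * t) = r * (D / κ * Real.exp (κ * t)) := by ring
          rw [this]; gcongr; linarith
        rw [abs_le]; constructor <;> linarith
    | succ n ih =>
      intro t ht
      set S := S0 / 2 ^ n with hS
      have hSn : 0 ≤ S := by positivity
      have hS' : S0 / 2 ^ (n + 1) = 1 / 2 * S := by rw [hS, pow_succ]; field_simp
      have hE := Real.exp_pos (κ * t)
      rw [hS']
      have htI : t ∈ Set.Icc 0 t1 := ⟨ht.1.le, ht.2⟩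
      refine ⟨by positivity, fun x v => ?_, fun r hr => ?_⟩
      · have u1 := half_f hf hg hC10 hκ hSn
          (fun t ht x v hx hv => hC1 t ht _ (ih t ht) x v hx hv) h0 t htI x v
        have u2 := half_f hg hf hC10 hκ hSn
          (fun t ht x v hx hv => by
            have := hC1 t ht _ (ih t ht) x v hx hv
            rw [norm_sub_rev, norm_sub_rev (F2 q lamg mug (ldot lamg) eg t x v)]
            exact this) (fun x v => (h0 x v).symm) t htI x v
        have u3 : 2 * K * C1 * S / κ * Real.exp (κ * t) ≤ 1 / 2 * S * Real.exp (κ * t) := by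
          have : 2 * K * C1 * S / κ = 2 * K * C1 / κ * S := by ring
          rw [this]; gcongr
        rw [abs_le]; constructor <;> linarith
      · have hr0 := hr.1
        have hcc : 0 ≤ r * (C2 * S) := by positivity
        have bb := fun t ht => abs_le.1 (hC2 t ht _ (ih t ht) r hr)
        have u1 := half_lam hf.sol hg.sol hf.lt hκ hcc hr0 (fun t ht => by
          have := (bb t ht).2
          linarith) (hl0 r hr0) t htI
        have u2 := half_lam hg.sol hf.sol hf.lt hκ hcc hr0 (fun t ht => by
          have := (bb t ht).1
          linarith) (hl0 r hr0).symm t htI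
        have u3 : r * (C2 * S) / κ * Real.exp (κ * t) ≤ r * (1 / 2 * S * Real.exp (κ * t)) := by
          have : r * (C2 * S) / κ * Real.exp (κ * t) = r * (C2 / κ * S * Real.exp (κ * t)) := by ring
          rw [this]; gcongr
        rw [abs_le]; constructor <;> linarith
  intro t ht
  have hlim : Tendsto (fun n : ℕ => S0 / 2 ^ n * Real.exp (κ * t)) atTop (𝓝 0) := by
    have h1 : Tendsto (fun n : ℕ => S0 * Real.exp (κ * t) * (1 / 2 : ℝ) ^ n) atTop (𝓝 (S0 * Real.exp (κ * t) * 0)) :=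
      (tendsto_pow_atTop_nhds_zero_of_lt_one (by norm_num) (by norm_num)).const_mul _
    rw [mul_zero] at h1
    refine h1.congr (fun n => ?_)
    rw [one_div, inv_pow]; ring
  refine ⟨le_rfl, fun x v => ge_of_tendsto' hlim (fun n => (key n t ht).2.1 x v), fun r hr => ?_⟩
  exact ge_of_tendsto' (hlim.const_mul r) (fun n => (key n t ht).2.2 r hr)

end

lemma main_uniqueness
    (q T : ℝ)
    (lamf muf ef : ℝ → ℝ → ℝ) (f : ℝ → E3 → E3 → ℝ)
    (lamg mug eg : ℝ → ℝ → ℝ) (g : ℝ → E3 → E3 → ℝ)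
    (hf : RegularSolution q (Set.Ico 0 T) lamf muf ef f)
    (hg : RegularSolution q (Set.Ico 0 T) lamg mug eg g)
    (hfg0 : ∀ x v : E3, f 0 x v = g 0 x v)
    (hlam0 : ∀ r : ℝ, 0 ≤ r → lamf 0 r = lamg 0 r)
    (hmu0 : ∀ r : ℝ, 0 ≤ r → muf 0 r = mug 0 r)
    (he0 : ∀ r : ℝ, 0 ≤ r → ef 0 r = eg 0 r) :
    ∀ t ∈ Set.Ico (0:ℝ) T,
      (∀ x v : E3, f t x v = g t x v) ∧
      (∀ r : ℝ, 0 ≤ r → lamf t r = lamg t r ∧ muf t r = mug t r ∧ ef t r = eg t r) := by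
  intro t ht
  rcases ht.1.eq_or_lt with h | hpos
  · subst h
    exact ⟨hfg0, fun r hr => ⟨hlam0 r hr, hmu0 r hr, he0 r hr⟩⟩
  obtain ⟨P1, hP10, hP1⟩ := unif_supp hf ht.1 ht.2
  obtain ⟨P2, hP20, hP2⟩ := unif_supp hg ht.1 ht.2
  have htI : t ∈ Set.Ioc 0 t := ⟨hpos, le_rfl⟩
  have main : ∀ r : ℝ, 0 ≤ r → (∀ x v : E3, f t x v = g t x v) ∧
      (lamf t r = lamg t r ∧ muf t r = mug t r ∧ ef t r = eg t r) := by
    intro r hr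
    have hR : 0 < P1 + P2 + r + 1 := by positivity
    obtain ⟨K1, hK1⟩ := exists_BdSol hf ht.2 hP1 hR (by linarith)
    obtain ⟨K2, hK2⟩ := exists_BdSol hg ht.2 hP2 hR (by linarith)
    have h1 := hK1.mono (le_max_left K1 K2)
    have h2 := hK2.mono (le_max_right K1 K2)
    have hc := all_close h1 h2 hfg0 hlam0 t htI
    have hrI : r ∈ Set.Icc 0 (P1 + P2 + r + 1) := ⟨hr, by linarith⟩
    obtain ⟨C1, -, hC1⟩ := est_mu h1 h2
    obtain ⟨C2, -, hC2⟩ := est_E h1 h2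
    have z : ∀ {a b : ℝ}, |a - b| ≤ 0 → a = b := fun h =>
      sub_eq_zero.1 (abs_nonpos_iff.1 h)
    have m := z (by simpa using hC1 t htI 0 hc r hrI)
    have E := z (by simpa using hC2 t htI 0 hc r hrI)
    have l := z (by simpa using hc.2.2 r hrI)
    rw [l] at E
    exact ⟨fun x v => z (hc.2.1 x v), l, m, mul_left_cancel₀ (Real.exp_pos _).ne' E⟩
  exact ⟨(main 0 le_rfl).1, fun r hr => (main r hr).2⟩

/-- uniqueness: two regular solutions of the full spherically
symmetric Einstein–Vlasov–Maxwell system on `[0,T)` with the same initial data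
coincide. -/
theorem uniqueness_of_solutions
    (q T : ℝ)
    (lamf muf ef : ℝ → ℝ → ℝ) (f : ℝ → E3 → E3 → ℝ)
    (lamg mug eg : ℝ → ℝ → ℝ) (g : ℝ → E3 → E3 → ℝ)
    (hf : RegularSolution q (Set.Ico 0 T) lamf muf ef f)
    (hg : RegularSolution q (Set.Ico 0 T) lamg mug eg g)
    (hfg0 : ∀ x v : E3, f 0 x v = g 0 x v)
    (hlam0 : ∀ r : ℝ, 0 ≤ r → lamf 0 r = lamg 0 r)
    (hmu0 : ∀ r : ℝ, 0 ≤ r → muf 0 r = mug 0 r)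
    (he0 : ∀ r : ℝ, 0 ≤ r → ef 0 r = eg 0 r) :
    ∀ t ∈ Set.Ico (0:ℝ) T,
      (∀ x v : E3, f t x v = g t x v) ∧
      (∀ r : ℝ, 0 ≤ r → lamf t r = lamg t r ∧ muf t r = mug t r ∧ ef t r = eg t r) := by
  exact main_uniqueness q T lamf muf ef f lamg mug eg g hf hg hfg0 hlam0 hmu0 he0

end EVM
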